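/- arXiv:1111.5561 — 2 statements merged into one kernel-verified Lean document; each statement's English description precedes it below -/
import Mathlib

section
/- Let f be a homeomorphism of the torus T² homotopic to a Dehn twist, with lift f̂ to the vertical cylinder. If f is minimal (every f-orbit is dense in T²), then the vertical rotation set ρ_V(f̂) consists of a single point {α}, where α is an irrational number. -/
noncomputable section

open MeasureTheory

abbrev Torus := AddCircle (1 : ℝ) × AddCircle (1 : ℝ)
abbrev Cyl := AddCircle (1 : ℝ) × ℝ

/-- The covering map from the plane to the vertical cylinder. -/
def projCyl (z : ℝ × ℝ) : Cyl := ((z.1 : AddCircle (1 : ℝ)), z.2)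

/-- The covering map from the plane to the torus. -/
def projTorus (z : ℝ × ℝ) : Torus := ((z.1 : AddCircle (1 : ℝ)), (z.2 : AddCircle (1 : ℝ)))

/-- A lift to the plane of a torus homeomorphism homotopic to a Dehn twist:
a homeomorphism of the plane commuting with integer horizontal translations and
satisfying the Dehn-twist relation for vertical translations, with twist
coefficient `k > 0`. -/
structure DehnLift where
  F : (ℝ × ℝ) ≃ₜ (ℝ × ℝ)
  k : ℤ
  k_pos : 0 < k
  horiz : ∀ x y : ℝ, F (x + 1, y) = F (x, y) + (1, 0)
  vert : ∀ x y : ℝ, F (x, y + 1) = F (x, y) + ((k : ℝ), 1)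

/-- The vertical rotation set of a cylinder map:
`ρ_V(f̂) = ∩_{i≥1} closure( ∪_{n≥i} { (p₂(f̂ⁿ(ẑ)) − p₂(ẑ))/n : ẑ ∈ A } )`. -/
def rotSet (fhat : Cyl → Cyl) : Set ℝ :=
  ⋂ i : ℕ, closure (⋃ n : ℕ, ⋃ _ : i + 1 ≤ n,
    {r : ℝ | ∃ z : Cyl, r = ((fhat^[n] z).2 - z.2) / n})

/-- A subset of the cylinder is bounded iff its second-coordinate projection is
a bounded subset of `ℝ`. -/
def VBounded (S : Set Cyl) : Prop := ∃ M : ℝ, ∀ z ∈ S, |z.2| ≤ M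

/-- `B⁻ = {ẑ : f̂ⁿ(ẑ) ∈ H⁻ for all n ≥ 0}` where `H⁻ = (ℝ/ℤ)×(−∞,0]`. -/
def Bminus (fhat : Cyl → Cyl) : Set Cyl := {z | ∀ n : ℕ, (fhat^[n] z).2 ≤ 0}

/-- `B⁺ = {ẑ : f̂ⁿ(ẑ) ∈ H⁺ for all n ≥ 0}` where `H⁺ = (ℝ/ℤ)×[0,∞)`. -/
def Bplus (fhat : Cyl → Cyl) : Set Cyl := {z | ∀ n : ℕ, 0 ≤ (fhat^[n] z).2}

/-- `B_S⁻`: the union of the unbounded connected components of `B⁻`. -/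
def BS (fhat : Cyl → Cyl) : Set Cyl :=
  {z | z ∈ Bminus fhat ∧ ¬ VBounded (connectedComponentIn (Bminus fhat) z)}

/-- `B_N⁺`: the union of the unbounded connected components of `B⁺`. -/
def BN (fhat : Cyl → Cyl) : Set Cyl :=
  {z | z ∈ Bplus fhat ∧ ¬ VBounded (connectedComponentIn (Bplus fhat) z)}

/-- The ω-limit set `ω(S) = ∩_{n≥0} closure(∪_{i≥n} f̂ⁱ(S))`. -/
def omegaSet (fhat : Cyl → Cyl) (S : Set Cyl) : Set Cyl :=
  ⋂ n : ℕ, closure (⋃ i : ℕ, ⋃ _ : n ≤ i, fhat^[i] '' S)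

noncomputable section
open MeasureTheory

namespace MinTwist
open Complex

theorem exists_log {X : Type*} [TopologicalSpace X] [SimplyConnectedSpace X]
    [LocallyPathConnectedSpace X] (h : X → ℂ) (hc : Continuous h) (h0 : ∀ x, h x ≠ 0) :
    ∃ l : X → ℂ, Continuous l ∧ ∀ x, exp (l x) = h x := by
  obtain ⟨x₀⟩ : Nonempty X := inferInstance
  rcases isCoveringMapOn_exp.existsUnique_continuousMap_lifts
    ⟨h, hc⟩ (exp_log (h0 x₀)) (fun x => h0 x) with ⟨f, ⟨-, hf⟩, -⟩
  exact ⟨f, f.continuous, fun x => congrFun hf x⟩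

theorem const_of_int {X : Type*} [TopologicalSpace X] {s : Set X} (hs : IsPreconnected s)
    (f : X → ℝ) (hf : ContinuousOn f s)
    (hn : ∀ x ∈ s, ∃ n : ℤ, f x = n * (2 * Real.pi)) {x y : X} (hx : x ∈ s) (hy : y ∈ s) :
    f x = f y := by
  have h1 : ContinuousOn (fun x => f x / (2 * Real.pi)) s := by fun_prop
  have hpi := Real.pi_pos
  have h2 : IsPreconnected ((fun x => f x / (2 * Real.pi)) '' s) := hs.image _ h1
  have h3 : (fun x => f x / (2 * Real.pi)) '' s ⊆ Set.range (fun n : ℤ => (n : ℝ)) := by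
    rintro _ ⟨z, hz, rfl⟩
    obtain ⟨n, hn⟩ := hn z hz
    exact ⟨n, by simp only [hn]; field_simp⟩
  have h4 : Set.Subsingleton (Set.image (fun x => f x / (2 * Real.pi)) s) := by
    have h5 : IsTotallyDisconnected (Set.range (fun n : ℤ => (n : ℝ))) :=
      (Set.countable_range _).isTotallyDisconnected
    exact h5 _ h3 h2
  have := h4 ⟨x, hx, rfl⟩ ⟨y, hy, rfl⟩
  simp only at this
  field_simp at this
  exact this

/-- Maps of the plane that rotate differences by a continuous symmetric angle. -/
structure GG (G : ℂ → ℂ) : Prop where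
  cont : Continuous G
  ang : ∃ g : ℂ → ℂ → ℝ, ContinuousOn (fun p : ℂ × ℂ => g p.1 p.2) {p | p.1 ≠ p.2} ∧
    (∀ a b, a ≠ b → ∃ r : ℝ, 0 < r ∧ G a - G b = r * exp (g a b * I) * (a - b)) ∧
    ∀ a b, a ≠ b → g a b = g b a

theorem GG.inj {G : ℂ → ℂ} (h : GG G) : Function.Injective G := by
  intro a b hab
  by_contra hne
  obtain ⟨g, -, h2, -⟩ := h.ang
  obtain ⟨r, hr, h3⟩ := h2 a b hne
  rw [hab, sub_self] at h3
  have : (r : ℂ) * exp (g a b * I) * (a - b) ≠ 0 :=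
    mul_ne_zero (mul_ne_zero (by exact_mod_cast hr.ne') (exp_ne_zero _)) (sub_ne_zero.2 hne)
  exact this h3.symm

theorem GG.comp {G H : ℂ → ℂ} (hG : GG G) (hH : GG H) : GG (fun z => G (H z)) := by
  obtain ⟨g, g1, g2, g3⟩ := hG.ang
  obtain ⟨h, h1, h2, h3⟩ := hH.ang
  refine ⟨hG.cont.comp hH.cont, fun a b => g (H a) (H b) + h a b, ?_, ?_, ?_⟩
  · refine ContinuousOn.add ?_ h1
    have : ContinuousOn (fun p : ℂ × ℂ => (H p.1, H p.2)) {p | p.1 ≠ p.2} := by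
      have := hH.cont
      fun_prop
    exact g1.comp this (fun p hp => hH.inj.ne hp)
  · intro a b hab
    obtain ⟨r, hr, e1⟩ := h2 a b hab
    obtain ⟨s, hs, e2⟩ := g2 _ _ (hH.inj.ne hab)
    refine ⟨s * r, by positivity, ?_⟩
    rw [e2, e1]
    push_cast
    rw [add_mul, exp_add]
    ring
  · intro a b hab
    simp only [h3 a b hab, g3 _ _ (hH.inj.ne hab)]

/-- Two nonzero complex numbers with the same direction. -/
theorem angle_int {r s : ℝ} (hr : 0 < r) (hs : 0 < s) {t : ℝ}
    (h : (r : ℂ) * exp (t * I) = s) : ∃ n : ℤ, t = n * (2 * Real.pi) := by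
  have h1 : ‖(r : ℂ) * exp (t * I)‖ = ‖(s : ℂ)‖ := by rw [h]
  rw [norm_mul, norm_exp_ofReal_mul_I, mul_one, norm_real, norm_real, Real.norm_of_nonneg hr.le,
    Real.norm_of_nonneg hs.le] at h1
  subst h1
  have h2 : exp (t * I) = 1 := by
    have : (r : ℂ) ≠ 0 := by exact_mod_cast hr.ne'
    field_simp at h
    exact h
  rw [exp_eq_one_iff] at h2
  obtain ⟨n, hn⟩ := h2
  refine ⟨n, ?_⟩
  have := congrArg Complex.im hn
  simpa using this

theorem GG.period_two {G : ℂ → ℂ} (h : GG G) (hfp : ∀ z, G z ≠ z) (z : ℂ) : G (G z) ≠ z := by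
  intro hz
  obtain ⟨g, g1, g2, g3⟩ := h.ang
  have hc := h.cont
  obtain ⟨l, l1, l2⟩ := exists_log (fun z => G z - z) (by fun_prop)
    (fun z => sub_ne_zero.2 (hfp z))
  have key : ∀ w, ∃ n : ℤ, (l (G w)).im - (l w).im - g (G w) w = n * (2 * Real.pi) := by
    intro w
    obtain ⟨r, hr, e⟩ := g2 (G w) w (hfp w)
    have e1 : exp (l (G w)) = r * exp (g (G w) w * I) * exp (l w) := by rw [l2, l2, e]
    have e2 : (Real.exp (l (G w)).re : ℂ) * exp (((l (G w)).im - (l w).im - g (G w) w : ℝ) * I)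
        = (r * Real.exp (l w).re : ℝ) := by
      have a1 : exp (l (G w)) = Real.exp (l (G w)).re * exp ((l (G w)).im * I) := by
        conv_lhs => rw [← re_add_im (l (G w))]
        rw [exp_add, ofReal_exp]
      have a2 : exp (l w) = Real.exp (l w).re * exp ((l w).im * I) := by
        conv_lhs => rw [← re_add_im (l w)]
        rw [exp_add, ofReal_exp]
      rw [a1, a2] at e1
      push_cast
      rw [sub_mul, sub_mul, exp_sub, exp_sub]
      have b1 := exp_ne_zero ((l w).im * I)
      have b2 := exp_ne_zero (g (G w) w * I)
      push_cast at e1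
      field_simp
      rw [e1]; ring
    exact angle_int (Real.exp_pos _) (by positivity) e2
  have hcont : Continuous (fun w => (l (G w)).im - (l w).im - g (G w) w) := by
    have : Continuous (fun w => g (G w) w) := by
      have h3 : Continuous (fun w => (G w, w)) := by fun_prop
      exact g1.comp_continuous h3 (fun w => hfp w)
    exact ((continuous_im.comp (l1.comp hc)).sub (continuous_im.comp l1)).sub this
  have hk := const_of_int isPreconnected_univ _ hcont.continuousOn (fun w _ => key w)
    (Set.mem_univ z) (Set.mem_univ (G z))
  simp only [hz] at hk
  rw [g3 z (G z) (hfp z).symm] at hk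
  obtain ⟨n, hn⟩ := key z
  have e : (l (G z)).im - (l z).im = 0 := by linarith
  have m1 := l2 (G z)
  have m2 := l2 z
  rw [hz] at m1
  have m3 : exp (l (G z) - l z) = -1 := by
    rw [exp_sub, m1, m2]
    have := sub_ne_zero.2 (hfp z)
    rw [div_eq_iff this]; ring
  have m4 : l (G z) - l z = ((l (G z)).re - (l z).re : ℝ) := by
    apply Complex.ext
    · simp
    · simpa using e
  rw [m4, ← ofReal_exp] at m3
  have m5 : Real.exp ((l (G z)).re - (l z).re) = -1 := by exact_mod_cast m3
  linarith [Real.exp_pos ((l (G z)).re - (l z).re)]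

theorem GG.pow_two {G : ℂ → ℂ} (h : GG G) (hfp : ∀ z, G z ≠ z) (m : ℕ) :
    GG (G^[2 ^ m]) ∧ ∀ z, G^[2 ^ m] z ≠ z := by
  induction m with
  | zero => simpa using ⟨h, hfp⟩
  | succ m ih =>
    have e : G^[2 ^ (m + 1)] = fun z => G^[2 ^ m] (G^[2 ^ m] z) := by
      funext z
      rw [pow_succ, mul_two, Function.iterate_add_apply]
    rw [e]
    exact ⟨ih.1.comp ih.1, ih.1.period_two ih.2⟩

/-- If difference quotients stay in the slit plane then the map is of class `GG`. -/
theorem GG.of_slit {G : ℂ → ℂ} (hc : Continuous G)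
    (h : ∀ a b, a ≠ b → (G a - G b) / (a - b) ∈ slitPlane) : GG G := by
  refine ⟨hc, fun a b => arg ((G a - G b) / (a - b)), ?_, ?_, ?_⟩
  · intro p hp
    apply ContinuousAt.continuousWithinAt
    apply ContinuousAt.comp (g := arg)
    · exact continuousAt_arg (h _ _ hp)
    · have : p.1 - p.2 ≠ 0 := sub_ne_zero.2 hp
      fun_prop (disch := assumption)
  · intro a b hab
    have h0 := slitPlane_ne_zero (h a b hab)
    refine ⟨‖(G a - G b) / (a - b)‖, norm_pos_iff.2 h0, ?_⟩
    rw [norm_mul_exp_arg_mul_I, div_mul_cancel₀ _ (sub_ne_zero.2 hab)]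
  · intro a b hab
    simp only
    rw [← neg_sub (G b), ← neg_sub b, neg_div_neg_eq]

theorem GG.hshear (ψ : ℝ → ℝ) (hψ : Continuous ψ) : GG (fun z => z + (ψ z.im : ℝ)) := by
  refine GG.of_slit (by fun_prop) ?_
  intro a b hab
  have h0 := sub_ne_zero.2 hab
  rw [show a + (ψ a.im : ℂ) - (b + (ψ b.im : ℂ)) = (a - b) + ((ψ a.im - ψ b.im : ℝ) : ℂ) by
    push_cast; ring, add_div, div_self h0, mem_slitPlane_iff]
  by_cases hi : a.im = b.im
  · left; simp [hi]
  · by_cases hp : ψ a.im - ψ b.im = 0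
    · left; simp [hp]
    · right
      have hn : normSq (a - b) ≠ 0 := by simpa using h0
      have hi' : b.im - a.im ≠ 0 := sub_ne_zero.2 (Ne.symm hi)
      simp only [add_im, one_im, zero_add, div_im, ofReal_im, ofReal_re, sub_im, zero_mul,
        zero_div, zero_sub]
      rw [neg_ne_zero]
      exact div_ne_zero (mul_ne_zero hp (sub_ne_zero.2 hi)) hn

theorem GG.vshear (ψ : ℝ → ℝ) (hψ : Continuous ψ) : GG (fun z => z + (ψ z.re : ℝ) * I) := by
  refine GG.of_slit (by fun_prop) ?_
  intro a b hab
  have h0 := sub_ne_zero.2 hab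
  rw [show a + (ψ a.re : ℂ) * I - (b + (ψ b.re : ℂ) * I)
    = (a - b) + ((ψ a.re - ψ b.re : ℝ) : ℂ) * I by
    push_cast; ring, add_div, div_self h0, mem_slitPlane_iff]
  by_cases hi : a.re = b.re
  · left; simp [hi]
  · by_cases hp : ψ a.re - ψ b.re = 0
    · left; simp [hp]
    · right
      have hn : normSq (a - b) ≠ 0 := by simpa using h0
      have hi' : a.re - b.re ≠ 0 := sub_ne_zero.2 hi
      simp only [add_im, one_im, zero_add, div_im, mul_im, mul_re, ofReal_im, ofReal_re, sub_re,
        I_re, I_im, zero_mul, mul_zero, mul_one, add_zero, zero_div, sub_zero]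
      exact div_ne_zero (mul_ne_zero hp hi') hn

end MinTwist
end

noncomputable section
open MeasureTheory

namespace MinTwist
open Complex

/-- Lifts to the plane of torus homeomorphisms homotopic to a Dehn twist. -/
structure Tw (F : ℂ ≃ₜ ℂ) (K : ℤ) : Prop where
  pos : 0 < K
  hor : ∀ z, F (z + 1) = F z + 1
  ver : ∀ z, F (z + I) = F z + K + I

theorem Tw.hor_int {F : ℂ ≃ₜ ℂ} {K : ℤ} (h : Tw F K) (z : ℂ) (a : ℤ) : F (z + a) = F z + a := by
  induction a using Int.induction_on generalizing z with
  | zero => simp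
  | succ n ih => push_cast at *; rw [← add_assoc, h.hor, ih]; ring
  | pred n ih =>
    have := h.hor (z + (-(n : ℤ) - 1 : ℤ))
    have e : z + (-(n : ℤ) - 1 : ℤ) + 1 = z + (-(n : ℤ) : ℤ) := by push_cast; ring
    rw [e, ih] at this
    have e2 : F (z + (-(n : ℤ) - 1 : ℤ)) = F z + (-(n : ℤ) : ℤ) - 1 := by rw [this]; ring
    rw [e2]; push_cast; ring

theorem Tw.ver_int {F : ℂ ≃ₜ ℂ} {K : ℤ} (h : Tw F K) (z : ℂ) (b : ℤ) :
    F (z + b * I) = F z + b * K + b * I := by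
  induction b using Int.induction_on generalizing z with
  | zero => simp
  | succ n ih =>
    have e : z + ((n : ℤ) + 1 : ℤ) * I = z + (n : ℤ) * I + I := by push_cast; ring
    rw [e, h.ver, ih]; push_cast; ring
  | pred n ih =>
    have := h.ver (z + (-(n : ℤ) - 1 : ℤ) * I)
    have e : z + (-(n : ℤ) - 1 : ℤ) * I + I = z + (-(n : ℤ) : ℤ) * I := by push_cast; ring
    rw [e, ih] at this
    have e2 : F (z + (-(n : ℤ) - 1 : ℤ) * I)
      = F z + (-(n : ℤ) : ℤ) * K + (-(n : ℤ) : ℤ) * I - K - I := by rw [this]; ring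
    rw [e2]; push_cast; ring

theorem Tw.lat {F : ℂ ≃ₜ ℂ} {K : ℤ} (h : Tw F K) (z : ℂ) (a b : ℤ) :
    F (z + a + b * I) = F z + a + b * K + b * I := by
  rw [h.ver_int, h.hor_int]

/-- The closed unit square. -/
def sq : Set ℂ := Set.Icc (0 : ℝ) 1 ×ℂ Set.Icc (0 : ℝ) 1

theorem isCompact_sq : IsCompact sq := isCompact_Icc.reProdIm isCompact_Icc

theorem sq_mem {z : ℂ} : z ∈ sq ↔ (0 ≤ z.re ∧ z.re ≤ 1) ∧ (0 ≤ z.im ∧ z.im ≤ 1) := by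
  simp [sq, mem_reProdIm]

theorem exists_sq (z : ℂ) : ∃ w ∈ sq, ∃ a b : ℤ, z = w + a + b * I := by
  refine ⟨z - ⌊z.re⌋ - ⌊z.im⌋ * I, ?_, ⌊z.re⌋, ⌊z.im⌋, by ring⟩
  rw [sq_mem]
  simp only [sub_re, sub_im, mul_re, mul_im, I_re, I_im, intCast_re, intCast_im, mul_zero, mul_one,
    sub_zero, zero_mul, add_zero]
  have := Int.floor_le z.re
  have := Int.lt_floor_add_one z.re
  have := Int.floor_le z.im
  have := Int.lt_floor_add_one z.im
  refine ⟨⟨?_, ?_⟩, ?_, ?_⟩ <;> linarith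

theorem bdd_of_periodic {E : Type*} [NormedAddCommGroup E] (φ : ℂ → E) (hc : Continuous φ)
    (hp : ∀ z (a b : ℤ), φ (z + a + b * I) = φ z) : ∃ B : ℝ, 0 ≤ B ∧ ∀ z, ‖φ z‖ ≤ B := by
  obtain ⟨B, hB⟩ := isCompact_sq.exists_bound_of_continuousOn hc.continuousOn
  refine ⟨max B 0, le_max_right _ _, fun z => ?_⟩
  obtain ⟨w, hw, a, b, rfl⟩ := exists_sq z
  rw [hp]
  exact (hB w hw).trans (le_max_left _ _)

theorem Tw.bdd {F : ℂ ≃ₜ ℂ} {K : ℤ} (h : Tw F K) :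
    ∃ B : ℝ, 0 ≤ B ∧ ∀ z, ‖F z - z - (K * z.im : ℝ)‖ ≤ B := by
  have := F.continuous
  apply bdd_of_periodic (fun z => F z - z - (K * z.im : ℝ)) (by fun_prop)
  intro z a b
  rw [h.lat]
  simp
  ring

theorem Tw.slit {F : ℂ ≃ₜ ℂ} {K : ℤ} (h : Tw F K) :
    ∃ R : ℝ, 0 < R ∧ ∀ w : ℂ, ‖w‖ = R → (F w - F 0) / w ∈ slitPlane := by
  obtain ⟨B, hB, hb⟩ := h.bdd
  have hK : (1 : ℝ) ≤ K := by exact_mod_cast h.pos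
  refine ⟨8 * K * B + 1, by positivity, fun w hw => ?_⟩
  set R : ℝ := 8 * K * B + 1 with hR
  have hR0 : 0 < R := by positivity
  have hw0 : w ≠ 0 := by rintro rfl; simp at hw; linarith
  set β : ℂ := (F w - w - (K * w.im : ℝ)) - F 0 with hβ
  have hbn : ‖β‖ ≤ 2 * B := by
    have h1 := hb w
    have h2 := hb 0
    simp only [sub_zero, zero_im, mul_zero, ofReal_zero] at h2
    calc ‖β‖ ≤ _ := norm_sub_le _ _
      _ ≤ 2 * B := by linarith
  have e : (F w - F 0) / w = ((w + (K * w.im : ℝ) + β) * (starRingEnd ℂ) w) * ((R ^ 2)⁻¹ : ℝ) := by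
    have : w * (starRingEnd ℂ) w = (R ^ 2 : ℝ) := by rw [mul_conj, normSq_eq_norm_sq, hw]
    have hc : (starRingEnd ℂ) w ≠ 0 := by simpa using hw0
    rw [ofReal_inv, ← this, hβ]
    field_simp
    ring
  have hg : ‖β * (starRingEnd ℂ) w‖ ≤ 2 * B * R := by
    rw [norm_mul, RCLike.norm_conj, hw]
    gcongr
  set γ := β * (starRingEnd ℂ) w with hγ
  have hre : |γ.re| ≤ 2 * B * R := (abs_re_le_norm _).trans hg
  have him : |γ.im| ≤ 2 * B * R := (abs_im_le_norm _).trans hg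
  have hn : w.re ^ 2 + w.im ^ 2 = R ^ 2 := by
    rw [← hw, ← normSq_eq_norm_sq, normSq_apply]; ring
  have e2 : (w + (K * w.im : ℝ) + β) * (starRingEnd ℂ) w
      = ((R ^ 2 + K * w.im * w.re + γ.re : ℝ) : ℂ) + ((- K * w.im ^ 2 + γ.im : ℝ) : ℂ) * I := by
    rw [add_mul, ← hγ, ← hn]
    apply Complex.ext
    · simp only [add_re, mul_re, ofReal_re, ofReal_im, conj_re, conj_im, I_re, I_im, add_im, mul_im]
      ring
    · simp only [add_re, mul_re, ofReal_re, ofReal_im, conj_re, conj_im, I_re, I_im, add_im, mul_im]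
      ring
  rw [e, e2, mem_slitPlane_iff]
  have hRi : 0 < (R ^ 2)⁻¹ := by positivity
  simp only [mul_re, mul_im, add_re, add_im, ofReal_re, ofReal_im, I_re, I_im, mul_zero, mul_one,
    sub_zero, add_zero, zero_add, zero_sub, neg_zero]
  by_cases hi : - K * w.im ^ 2 + γ.im = 0
  · left
    have h1 : K * w.im ^ 2 ≤ 2 * B * R := by linarith [le_abs_self γ.im]
    have h2 : (K * |w.im|) ^ 2 < (R / 2) ^ 2 := by
      rw [mul_pow, sq_abs]
      have : (K : ℝ) ^ 2 * w.im ^ 2 ≤ K * (2 * B * R) := by nlinarith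
      nlinarith
    have h3 : K * |w.im| < R / 2 := lt_of_pow_lt_pow_left₀ 2 (by positivity) h2
    have h4 : |w.re| ≤ R := hw ▸ abs_re_le_norm w
    have h5 : |K * w.im * w.re| ≤ R / 2 * R := by
      rw [abs_mul, abs_mul, abs_of_pos (by linarith : (0 : ℝ) < K)]
      gcongr
    have h6 : -(2 * B * R) ≤ γ.re := by linarith [neg_abs_le γ.re]
    have h7 := neg_abs_le (K * w.im * w.re)
    have h8 : 2 * B < R / 2 := by nlinarith
    have h9 : 0 < R ^ 2 + K * w.im * w.re + γ.re := by nlinarith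
    exact mul_pos h9 hRi
  · right
    exact mul_ne_zero hi hRi.ne'

theorem same_exp {l l' : ℂ} (h : exp l = exp l') : ∃ n : ℤ, l.im - l'.im = n * (2 * Real.pi) := by
  rw [exp_eq_exp_iff_exists_int] at h
  obtain ⟨n, hn⟩ := h
  refine ⟨n, ?_⟩
  rw [hn]; simp

theorem Tw.gg {F : ℂ ≃ₜ ℂ} {K : ℤ} (h : Tw F K) : GG F := by
  have hF := F.continuous
  obtain ⟨l, l1, l2⟩ := exists_log
    (fun p : ℂ × ℂ => (F (p.1 + exp p.2) - F p.1) / exp p.2)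
    (Continuous.div (by fun_prop) (by fun_prop) (fun p => exp_ne_zero _))
    (fun p => div_ne_zero (sub_ne_zero.2 (F.injective.ne (by simp [exp_ne_zero])))
      (exp_ne_zero _))
  -- periodicity
  have hper0 : ∀ p q : ℂ × ℂ, (l (p.1, p.2 + 2 * Real.pi * I)).im - (l (p.1, p.2)).im
      = (l (q.1, q.2 + 2 * Real.pi * I)).im - (l (q.1, q.2)).im := by
    intro p q
    refine const_of_int isPreconnected_univ
      (fun p : ℂ × ℂ => (l (p.1, p.2 + 2 * Real.pi * I)).im - (l (p.1, p.2)).im)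
      (by fun_prop) ?_ (Set.mem_univ p) (Set.mem_univ q)
    intro p _
    apply same_exp
    rw [l2, l2]
    simp only [exp_add, exp_two_pi_mul_I, mul_one]
  obtain ⟨R, hR, hs⟩ := h.slit
  have hz : ∀ t : ℝ, ‖exp (Real.log R + t * I)‖ = R := by
    intro t
    rw [norm_exp]; simp [Real.exp_log hR]
  have hd : (l (0, Real.log R + 2 * Real.pi * I)).im - (l (0, Real.log R)).im = 0 := by
    have hq : ∀ t : ℝ, exp (l (0, Real.log R + t * I)) ∈ slitPlane := by
      intro t
      rw [l2]
      simpa using hs _ (hz t)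
    have := const_of_int isPreconnected_univ
      (fun t : ℝ => (l (0, Real.log R + t * I)).im - (log (exp (l (0, Real.log R + t * I)))).im)
      (by
        apply Continuous.continuousOn
        have h1 : Continuous (fun t : ℝ => exp (l (0, Real.log R + t * I))) := by fun_prop
        have h2 := h1.clog hq
        have h3 : Continuous (fun t : ℝ => (l (0, Real.log R + t * I)).im) := by fun_prop
        exact h3.sub (continuous_im.comp h2)) (fun t _ => same_exp (by rw [exp_log (exp_ne_zero _)]))
        (Set.mem_univ (0 : ℝ)) (Set.mem_univ (2 * Real.pi))
    simp only [ofReal_zero, zero_mul, add_zero, ofReal_mul, ofReal_ofNat] at this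
    have e : exp (l (0, Real.log R + 2 * Real.pi * I)) = exp (l (0, Real.log R)) := by
      rw [l2, l2]
      simp only [exp_add, exp_two_pi_mul_I, mul_one]
    rw [e] at this
    linarith
  have hper : ∀ a ζ, (l (a, ζ + 2 * Real.pi * I)).im = (l (a, ζ)).im := by
    intro a ζ
    have := hper0 (a, ζ) (0, Real.log R)
    simp only [hd] at this
    linarith
  have hpern : ∀ a ζ ζ', exp ζ = exp ζ' → (l (a, ζ)).im = (l (a, ζ')).im := by
    intro a ζ ζ' he
    rw [exp_eq_exp_iff_exists_int] at he
    obtain ⟨n, rfl⟩ := he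
    have : Function.Periodic (fun ζ => (l (a, ζ)).im) (2 * Real.pi * I) := fun ζ => hper a ζ
    exact this.int_mul n ζ'
  have hcont : ContinuousOn (fun p : ℂ × ℂ => (l (p.1, log (p.2 - p.1))).im) {p | p.1 ≠ p.2} := by
    intro p hp
    apply ContinuousAt.continuousWithinAt
    have hp0 : p.2 - p.1 ≠ 0 := sub_ne_zero.2 (Ne.symm hp)
    by_cases hsl : p.2 - p.1 ∈ slitPlane
    · have h1 : ContinuousAt (fun p : ℂ × ℂ => log (p.2 - p.1)) p :=
        ContinuousAt.clog (by fun_prop) hsl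
      have h2 : ContinuousAt (fun p : ℂ × ℂ => (p.1, log (p.2 - p.1))) p :=
        ContinuousAt.prodMk (by fun_prop) h1
      exact continuous_im.continuousAt.comp (l1.continuousAt.comp h2)
    · have hsl' : -(p.2 - p.1) ∈ slitPlane := by
        rw [mem_slitPlane_iff] at hsl ⊢
        push Not at hsl
        left
        have : (p.2 - p.1).re ≠ 0 := fun h0 => hp0 (Complex.ext h0 hsl.2)
        have := lt_of_le_of_ne hsl.1 this
        rw [neg_re]; linarith
      have h1 : ContinuousAt (fun p : ℂ × ℂ => log (-(p.2 - p.1))) p :=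
        ContinuousAt.clog (by fun_prop) hsl'
      have h2 : ContinuousAt (fun p : ℂ × ℂ => (p.1, log (-(p.2 - p.1)) + Real.pi * I)) p :=
        ContinuousAt.prodMk (by fun_prop) (h1.add continuousAt_const)
      have h3 : ContinuousAt (fun p : ℂ × ℂ => (l (p.1, log (-(p.2 - p.1)) + Real.pi * I)).im) p :=
        continuous_im.continuousAt.comp (l1.continuousAt.comp h2)
      refine h3.congr ?_
      have ho : IsOpen {p : ℂ × ℂ | p.1 ≠ p.2} := isOpen_ne_fun continuous_fst continuous_snd
      filter_upwards [ho.mem_nhds hp] with q hq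
      have hq0 : q.2 - q.1 ≠ 0 := sub_ne_zero.2 (Ne.symm hq)
      apply hpern
      rw [exp_add, exp_log (neg_ne_zero.2 hq0), exp_pi_mul_I, exp_log hq0]
      ring
  have hrat : ∀ a b, a ≠ b → F a - F b = exp (l (a, log (b - a))) * (a - b) := by
    intro a b hab
    have h0 : b - a ≠ 0 := sub_ne_zero.2 (Ne.symm hab)
    rw [l2]
    simp only
    rw [exp_log h0]
    field_simp
    rw [add_sub_cancel]
    ring
  refine ⟨hF, fun a b => (l (a, log (b - a))).im, hcont, ?_, ?_⟩
  · intro a b hab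
    refine ⟨Real.exp (l (a, log (b - a))).re, Real.exp_pos _, ?_⟩
    rw [hrat a b hab, ofReal_exp, ← exp_add, re_add_im]
  · intro a b hab
    have hc := const_of_int isPreconnected_univ
      (fun p : ℂ × ℂ => (l (p.1, log ((p.1 + exp p.2) - p.1))).im
        - (l (p.1 + exp p.2, log (p.1 - (p.1 + exp p.2)))).im)
      (by
        apply Continuous.continuousOn
        have k1 : Continuous (fun p : ℂ × ℂ => (p.1, p.1 + exp p.2)) := by fun_prop
        have k2 : Continuous (fun p : ℂ × ℂ => (p.1 + exp p.2, p.1)) := by fun_prop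
        have m1 := hcont.comp_continuous k1 (fun p => by simp [exp_ne_zero])
        have m2 := hcont.comp_continuous k2 (fun p => by simp [exp_ne_zero])
        exact m1.sub m2)
      (fun p _ => by
        apply same_exp
        have hne : p.1 ≠ p.1 + exp p.2 := by simp [exp_ne_zero]
        have a1 := hrat _ _ hne
        have a2 := hrat _ _ hne.symm
        have h0 : p.1 - (p.1 + exp p.2) ≠ 0 := sub_ne_zero.2 hne
        apply mul_right_cancel₀ h0
        rw [← a1]
        linear_combination -a2)
      (Set.mem_univ (a, log (b - a))) (Set.mem_univ (b, log (a - b)))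
    simp only at hc
    rw [exp_log (sub_ne_zero.2 hab), exp_log (sub_ne_zero.2 (Ne.symm hab))] at hc
    simp only [add_sub_cancel] at hc
    simp only
    linarith

end MinTwist
end

noncomputable section
open MeasureTheory

namespace MinTwist
open Complex

/-- Minimality of the induced torus map, phrased in the plane. -/
def MinP (Φ : ℂ → ℂ) : Prop :=
  ∀ E : Set ℂ, IsClosed E → E.Nonempty → (∀ z ∈ E, ∀ a b : ℤ, z + a + b * I ∈ E) →
    (∀ z ∈ E, Φ z ∈ E) → E = Set.univ

theorem count_trick {Φ : ℂ → ℂ} (hmin : MinP Φ) {ι : Type*} (C : ι → Set ℂ)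
    (hcl : ∀ i, IsClosed (C i)) (hlf : LocallyFinite C)
    (σ : ι → ι) (hσ : Function.Injective σ) (hΦ : ∀ z i, z ∈ C i → Φ z ∈ C (σ i))
    (hlat : ∀ a b : ℤ, ∃ τ : ι → ι, Function.Injective τ ∧
      ∀ z i, z ∈ C i → z + a + b * I ∈ C (τ i))
    (i₀ : ι) (hne : (C i₀).Nonempty) : C i₀ = Set.univ := by
  set N : ℂ → ℕ := fun z => {i | z ∈ C i}.ncard with hN
  have hfin : ∀ z, {i | z ∈ C i}.Finite := fun z => hlf.point_finite z
  have mono : ∀ z w (τ : ι → ι), Function.Injective τ → (∀ i, z ∈ C i → w ∈ C (τ i)) →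
      N z ≤ N w := by
    intro z w τ hτ h
    exact Set.ncard_le_ncard_of_injOn τ (fun i hi => h i hi) hτ.injOn (hfin w)
  have hev : ∀ x, ∀ᶠ y in nhds x, {i | y ∈ C i} ⊆ {i | x ∈ C i} := fun x =>
    hlf.eventually_subset hcl x
  have hclosed : ∀ m, IsClosed {z | m ≤ N z} := by
    intro m
    rw [← isOpen_compl_iff, isOpen_iff_mem_nhds]
    intro x hx
    filter_upwards [hev x] with y hy
    have h1 : N y ≤ N x := Set.ncard_le_ncard hy (hfin x)
    simp only [Set.mem_compl_iff, Set.mem_ofPred_eq, not_le] at hx ⊢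
    omega
  have hconst : ∀ x y, N x ≤ N y := by
    intro x y
    have := hmin {z | N x ≤ N z} (hclosed _) ⟨x, le_refl (N x)⟩ ?_ ?_
    · have h2 : y ∈ {z | N x ≤ N z} := this ▸ Set.mem_univ y
      exact h2
    · intro z hz a b
      obtain ⟨τ, h1, h2⟩ := hlat a b
      exact le_trans hz (mono _ _ τ h1 (h2 z))
    · intro z hz
      exact le_trans hz (mono _ _ σ hσ (hΦ z))
  have hopen : IsOpen (C i₀) := by
    rw [isOpen_iff_mem_nhds]
    intro x hx
    filter_upwards [hev x] with y hy
    have := Set.eq_of_subset_of_ncard_le hy (hconst x y) (hfin x)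
    have h2 : i₀ ∈ {i | x ∈ C i} := hx
    rw [← this] at h2
    exact h2
  exact IsClopen.eq_univ ⟨hcl i₀, hopen⟩ hne

/-- Lifts of minimal torus homeomorphisms homotopic to a Dehn twist. -/
structure Good (F : ℂ ≃ₜ ℂ) (K : ℤ) : Prop extends Tw F K where
  min : MinP F

theorem Tw.iter_hor {F : ℂ ≃ₜ ℂ} {K : ℤ} (h : Tw F K) (n : ℕ) (z : ℂ) (a : ℤ) :
    F^[n] (z + a) = F^[n] z + a := by
  induction n generalizing z with
  | zero => rfl
  | succ n ih => rw [Function.iterate_succ_apply, Function.iterate_succ_apply, h.hor_int, ih]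

theorem Tw.iter_lat {F : ℂ ≃ₜ ℂ} {K : ℤ} (h : Tw F K) (n : ℕ) (z : ℂ) (a b : ℤ) :
    F^[n] (z + a + b * I) = F^[n] z + ((a + n * K * b : ℤ) : ℂ) + b * I := by
  induction n generalizing z a with
  | zero => simp
  | succ n ih =>
    rw [Function.iterate_succ_apply, Function.iterate_succ_apply, h.lat]
    have := ih (F z) (a + b * K)
    push_cast at this ⊢
    rw [← add_assoc] at this
    rw [this]; ring

theorem Good.no_bdd {F : ℂ ≃ₜ ℂ} {K : ℤ} (h : Good F K) (z : ℂ) (B : ℝ)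
    (hb : ∀ n : ℕ, |(F^[n] z).im - z.im| ≤ B) : False := by
  set S : Set ℂ := {w | ∃ (n : ℕ) (a : ℤ), w = F^[n] z + a} with hS
  set M := closure S with hM
  have hMc : IsClosed M := isClosed_closure
  have hMb : ∀ w ∈ M, |w.im - z.im| ≤ B := by
    have hc : IsClosed {w : ℂ | |w.im - z.im| ≤ B} :=
      isClosed_le (by fun_prop) continuous_const
    apply closure_minimal _ hc
    rintro w ⟨n, a, rfl⟩
    simpa using hb n
  have hM1 : ∀ w ∈ M, ∀ a : ℤ, w + a ∈ M := by
    intro w hw a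
    have hm : Set.MapsTo (fun w : ℂ => w + a) S S := by
      rintro w ⟨n, a', rfl⟩
      exact ⟨n, a' + a, by push_cast; ring⟩
    exact hm.closure (by fun_prop) hw
  have hMF : ∀ w ∈ M, F w ∈ M := by
    intro w hw
    have hm : Set.MapsTo F S S := by
      rintro w ⟨n, a', rfl⟩
      exact ⟨n + 1, a', by rw [h.hor_int, Function.iterate_succ_apply']⟩
    exact hm.closure F.continuous hw
  have hz : z ∈ M := subset_closure ⟨0, 0, by simp⟩
  have := count_trick h.min (fun j : ℤ => {w : ℂ | w - j * I ∈ M})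
    (fun j => hMc.preimage (by fun_prop : Continuous fun w : ℂ => w - j * I))
    (by
      intro x
      refine ⟨Metric.ball x 1, Metric.ball_mem_nhds x one_pos, ?_⟩
      apply (Set.finite_Icc (⌈x.im - z.im - B - 1⌉) (⌊x.im - z.im + B + 1⌋)).subset
      rintro j ⟨w, hw1, hw2⟩
      have h1 := hMb _ hw1
      simp only [sub_im, mul_im, intCast_re, intCast_im, I_re, I_im, mul_one, mul_zero, zero_mul,
        add_zero] at h1
      have h2 : |(w - x).im| < 1 := (abs_im_le_norm _).trans_lt (by simpa [dist_eq_norm] using hw2)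
      rw [sub_im] at h2
      rw [abs_le] at h1
      rw [abs_lt] at h2
      constructor
      · rw [Int.ceil_le]; linarith
      · rw [Int.le_floor]; linarith)
    id Function.injective_id
    (by
      intro w j hw
      have h1 := hM1 _ (hMF _ hw) (j * K)
      have e : w - j * I = w + ((-j : ℤ) : ℂ) * I := by push_cast; ring
      rw [e, h.ver_int] at h1
      simp only [id, Set.mem_ofPred_eq]
      convert h1 using 1
      push_cast; ring)
    (by
      intro a b
      refine ⟨fun j => j + b, add_left_injective b, ?_⟩
      intro w j hw
      have h1 := hM1 _ hw a
      simp only [Set.mem_ofPred_eq]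
      convert h1 using 1
      push_cast; ring)
    0 ⟨z, by simpa using hz⟩
  have h2 : z + ((|B| + 1 : ℝ) : ℂ) * I ∈ {w : ℂ | w - (0 : ℤ) * I ∈ M} := by
    rw [this]; trivial
  have h3 := hMb _ h2
  simp at h3
  rw [abs_of_nonneg (by positivity)] at h3
  linarith [le_abs_self B]

end MinTwist
end

noncomputable section
open MeasureTheory

namespace MinTwist
open Complex

/-- `Ch F ε n z w`: an `ε`-chain of length `n` from `z` to `w`. -/
inductive Ch (F : ℂ → ℂ) (ε : ℝ) : ℕ → ℂ → ℂ → Prop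
  | one {z w : ℂ} (h : dist (F z) w < ε) : Ch F ε 1 z w
  | cons {n : ℕ} {z u w : ℂ} (h : dist (F z) u < ε) (hc : Ch F ε n u w) : Ch F ε (n + 1) z w

theorem Ch.pos {F : ℂ → ℂ} {ε : ℝ} {n : ℕ} {z w : ℂ} (h : Ch F ε n z w) : 1 ≤ n := by
  cases h <;> omega

theorem Ch.trans {F : ℂ → ℂ} {ε : ℝ} {n m : ℕ} {z u w : ℂ} (h : Ch F ε n z u)
    (h' : Ch F ε m u w) : Ch F ε (n + m) z w := by
  induction h with
  | one h => rw [add_comm]; exact Ch.cons h h'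
  | cons h hc ih => rw [add_right_comm]; exact Ch.cons h (ih h')

theorem Ch.iter {F : ℂ → ℂ} {ε : ℝ} (hε : 0 < ε) (n : ℕ) (z : ℂ) :
    Ch F ε (n + 1) z (F^[n + 1] z) := by
  induction n generalizing z with
  | zero => exact Ch.one (by simpa using hε)
  | succ n ih => exact Ch.cons (u := F z) (by simpa using hε) (ih (F z))

theorem Ch.lat {F : ℂ ≃ₜ ℂ} {K : ℤ} (hF : Tw F K) {ε : ℝ} {n : ℕ} {z w : ℂ}
    (h : Ch F ε n z w) (a b : ℤ) :
    Ch F ε n (z + a + b * I) (w + ((a + n * K * b : ℤ) : ℂ) + b * I) := by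
  induction h generalizing a with
  | one h =>
    apply Ch.one
    rw [hF.lat]
    convert h using 1
    rw [dist_eq_norm, dist_eq_norm]
    congr 1
    push_cast; ring
  | @cons n z u w h hc ih =>
    have := ih (a + b * K)
    have e : a + b * K + n * K * b = a + ((n + 1 : ℕ) : ℤ) * K * b := by push_cast; ring
    rw [e] at this
    refine Ch.cons ?_ this
    rw [hF.lat]
    convert h using 1
    rw [dist_eq_norm, dist_eq_norm]
    congr 1
    push_cast; ring

theorem Ch.ev {F : ℂ → ℂ} (hF : Continuous F) {ε : ℝ} {n : ℕ} {z w : ℂ} (h : Ch F ε n z w) :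
    ∀ᶠ p : ℂ × ℂ in nhds (z, w), Ch F ε n p.1 p.2 := by
  induction h with
  | @one z w h =>
    have ho : IsOpen {p : ℂ × ℂ | dist (F p.1) p.2 < ε} :=
      isOpen_lt (by fun_prop) continuous_const
    filter_upwards [ho.mem_nhds (show (z, w) ∈ _ from h)] with p hp
    exact Ch.one hp
  | @cons n z u w h hc ih =>
    have ho : IsOpen {p : ℂ × ℂ | dist (F p.1) u < ε} :=
      isOpen_lt (by fun_prop) continuous_const
    have ht : Filter.Tendsto (fun p : ℂ × ℂ => (u, p.2)) (nhds (z, w)) (nhds (u, w)) := by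
      have : Continuous (fun p : ℂ × ℂ => (u, p.2)) := by fun_prop
      exact this.tendsto (z, w)
    filter_upwards [ho.mem_nhds (show (z, w) ∈ _ from h), ht.eventually ih] with p hp hp2
    exact Ch.cons hp hp2

theorem Good.chain_trans {F : ℂ ≃ₜ ℂ} {K : ℤ} (h : Good F K) {ε : ℝ} (hε : 0 < ε) (z w : ℂ) :
    ∃ (n : ℕ) (a b : ℤ), Ch F ε n z (w + a + b * I) := by
  set R : Set ℂ := {w | ∃ (n : ℕ) (a b : ℤ), Ch F ε n z (w + a + b * I)} with hR
  have key : ∀ w ∈ closure R, F w ∈ R := by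
    intro w hw
    have ho : IsOpen {w' : ℂ | dist (F w') (F w) < ε} :=
      isOpen_lt (by have := F.continuous; fun_prop) continuous_const
    obtain ⟨w', hw1, n, a, b, hch⟩ := mem_closure_iff.1 hw _ ho (show dist _ _ < ε by simpa using hε)
    refine ⟨n + 1, a + b * K, b, hch.trans (Ch.one ?_)⟩
    rw [h.lat]
    have h2 : dist (F w') (F w) < ε := hw1
    convert h2 using 1
    rw [dist_eq_norm, dist_eq_norm]
    congr 1
    push_cast; ring
  have huniv : closure R = Set.univ := by
    apply h.min _ isClosed_closure
    · exact ⟨F z, subset_closure ⟨1, 0, 0, Ch.one (by simpa using hε)⟩⟩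
    · intro w hw a b
      have hm : Set.MapsTo (fun w : ℂ => w + a + b * I) R R := by
        rintro w ⟨n, a', b', hc⟩
        refine ⟨n, a' - a, b' - b, ?_⟩
        convert hc using 1
        push_cast; ring
      exact hm.closure (by fun_prop) hw
    · intro w hw
      exact subset_closure (key w hw)
  have := key (F.symm w) (huniv ▸ Set.mem_univ _)
  rwa [F.apply_symm_apply] at this

theorem Good.chain_unif {F : ℂ ≃ₜ ℂ} {K : ℤ} (h : Good F K) {ε : ℝ} (hε : 0 < ε) :
    ∃ C : ℝ, 0 ≤ C ∧ ∀ z w : ℂ, ∃ (n : ℕ) (a b : ℤ), Ch F ε n z (w + a + b * I) ∧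
      |w.im + b - z.im| ≤ C := by
  have h1 : ∃ C : ℝ, 0 ≤ C ∧ ∀ p ∈ sq ×ˢ sq, ∃ (n : ℕ) (a b : ℤ),
      Ch F ε n p.1 (p.2 + a + b * I) ∧ |(b : ℝ)| ≤ C := by
    refine (isCompact_sq.prod isCompact_sq).induction_on
      (p := fun S => ∃ C : ℝ, 0 ≤ C ∧ ∀ p ∈ S, ∃ (n : ℕ) (a b : ℤ),
        Ch F ε n p.1 (p.2 + a + b * I) ∧ |(b : ℝ)| ≤ C) ?_ ?_ ?_ ?_
    · exact ⟨0, le_rfl, by simp⟩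
    · rintro S T hST ⟨C, h0, hC⟩
      exact ⟨C, h0, fun p hp => hC p (hST hp)⟩
    · rintro S T ⟨C, h0, hC⟩ ⟨C', h0', hC'⟩
      refine ⟨max C C', le_max_of_le_left h0, ?_⟩
      rintro p (hp | hp)
      · obtain ⟨n, a, b, h1, h2⟩ := hC p hp
        exact ⟨n, a, b, h1, h2.trans (le_max_left _ _)⟩
      · obtain ⟨n, a, b, h1, h2⟩ := hC' p hp
        exact ⟨n, a, b, h1, h2.trans (le_max_right _ _)⟩
    · rintro ⟨z, w⟩ -
      obtain ⟨n, a, b, hc⟩ := h.chain_trans hε z w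
      have ht : Filter.Tendsto (fun p : ℂ × ℂ => (p.1, p.2 + a + b * I)) (nhds (z, w))
          (nhds (z, w + a + b * I)) := by
        have : Continuous (fun p : ℂ × ℂ => (p.1, p.2 + a + b * I)) := by fun_prop
        exact this.tendsto (z, w)
      refine ⟨_, mem_nhdsWithin_of_mem_nhds (ht.eventually (hc.ev F.continuous)), |(b : ℝ)|,
        abs_nonneg _, fun p hp => ⟨n, a, b, hp, le_rfl⟩⟩
  obtain ⟨C, h0, hC⟩ := h1
  refine ⟨C + 1, by positivity, fun z w => ?_⟩
  obtain ⟨z0, hz0, a1, b1, rfl⟩ := exists_sq z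
  obtain ⟨w0, hw0, a2, b2, rfl⟩ := exists_sq w
  obtain ⟨n, a, b, hc, hb⟩ := hC (z0, w0) ⟨hz0, hw0⟩
  have := hc.lat h.toTw a1 b1
  refine ⟨n, a + a1 + n * K * b1 - a2, b + b1 - b2, ?_, ?_⟩
  · convert this using 1
    push_cast; ring
  · rw [sq_mem] at hz0 hw0
    simp
    rw [abs_le] at hb ⊢
    constructor <;> linarith

theorem Good.loop_sign {F : ℂ ≃ₜ ℂ} {K : ℤ} (h : Good F K) {s : ℝ} (hs : s = 1 ∨ s = -1)
    (hN : ∀ N : ℕ, 1 ≤ N → ∃ z, s * ((F^[N] z).im - z.im) ≤ 0) {ε : ℝ} (hε : 0 < ε) (x : ℂ) :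
    ∃ (n : ℕ) (a v : ℤ), s * v < 0 ∧ Ch F ε n x (x + a + v * I) := by
  by_contra hcon
  push Not at hcon
  obtain ⟨C, hC0, hC⟩ := h.chain_unif hε
  have low : ∀ (n : ℕ) z, -(2 * C) ≤ s * ((F^[n] z).im - z.im) := by
    intro n z
    rcases n with _ | n
    · simp; exact hC0
    obtain ⟨n1, a, b, c1, e1⟩ := hC x z
    obtain ⟨n2, a2, b2, c2, e2⟩ := hC (F^[n + 1] (z + a + b * I)) x
    have c3 := (c1.trans (Ch.iter hε n _)).trans c2
    have c4 : 0 ≤ s * b2 := by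
      by_contra hlt
      exact hcon _ _ _ (not_le.1 hlt) c3
    rw [h.iter_lat] at e2
    simp at e2
    simp only [← Function.iterate_succ_apply] at e2
    rw [abs_le] at e1 e2
    rcases hs with rfl | rfl <;> linarith
  have per : ∀ (n : ℕ) z (a b : ℤ), (F^[n] (z + a + b * I)).im - (z + a + b * I).im
      = (F^[n] z).im - z.im := by
    intro n z a b
    rw [h.iter_lat]; simp
  have hcl : ∀ N : ℕ, IsClosed {z : ℂ | z ∈ sq ∧ ∀ n ≤ N, |(F^[n] z).im - z.im| ≤ 2 * C} := by
    intro N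
    have e : {z : ℂ | z ∈ sq ∧ ∀ n ≤ N, |(F^[n] z).im - z.im| ≤ 2 * C}
      = sq ∩ ⋂ n : ℕ, ⋂ _ : n ≤ N, {z : ℂ | |(F^[n] z).im - z.im| ≤ 2 * C} := by
      ext z; simp
    rw [e]
    refine isCompact_sq.isClosed.inter (isClosed_iInter fun n => isClosed_iInter fun _ => ?_)
    have := F.continuous.iterate n
    exact isClosed_le (by fun_prop) continuous_const
  have hne := IsCompact.nonempty_iInter_of_sequence_nonempty_isCompact_isClosed
    (fun N : ℕ => {z : ℂ | z ∈ sq ∧ ∀ n ≤ N, |(F^[n] z).im - z.im| ≤ 2 * C})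
    (fun N z hz => ⟨hz.1, fun n hn => hz.2 n (by omega)⟩)
    (by
      intro N
      obtain ⟨z, hz⟩ := hN (N + 1) (by omega)
      obtain ⟨w, hw, a, b, rfl⟩ := exists_sq z
      rw [per] at hz
      refine ⟨w, hw, fun n hn => ?_⟩
      have l1 := low n w
      have l2 := low (N + 1 - n) (F^[n] w)
      rw [← Function.iterate_add_apply, Nat.sub_add_cancel (by omega)] at l2
      rw [abs_le]
      rcases hs with rfl | rfl <;> constructor <;> linarith)
    (isCompact_sq.of_isClosed_subset (hcl 0) (fun z hz => hz.1)) hcl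
  obtain ⟨z, hz⟩ := hne
  rw [Set.mem_iInter] at hz
  exact h.no_bdd z (2 * C) (fun n => (hz n).2 n le_rfl)

theorem heis {L : ℕ → ℤ → ℤ → Prop} {K : ℤ} (hK : 0 < K) (npos : ∀ n v h, L n v h → 1 ≤ n)
    (hmul : ∀ n v h n' v' h', L n v h → L n' v' h' → L (n + n') (v + v') (h + h' + n' * K * v))
    {n m : ℕ} {v u h g : ℤ} (hv : 0 < v) (hu : 0 < u) (hX : L n v h) (hY : L m (-u) g) :
    ∃ N, L N 0 0 := by
  have pow : ∀ n v h, L n v h → ∀ r : ℕ, ∃ N h', L N ((r + 1 : ℕ) * v) h' := by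
    intro n v h hL r
    induction r with
    | zero => exact ⟨n, h, by simpa using hL⟩
    | succ r ih =>
      obtain ⟨N, h', ih⟩ := ih
      refine ⟨N + n, h' + h + n * K * ((r + 1 : ℕ) * v), ?_⟩
      convert hmul _ _ _ _ _ _ ih hL using 1
      push_cast; ring
  have pow0 : ∀ n h, L n 0 h → ∀ r : ℕ, ∃ N, r + 1 ≤ N ∧ L N 0 ((r + 1 : ℕ) * h) := by
    intro n h hL r
    have := npos _ _ _ hL
    induction r with
    | zero => exact ⟨n, by omega, by simpa using hL⟩
    | succ r ih =>
      obtain ⟨N, hN, ih⟩ := ih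
      refine ⟨N + n, by omega, ?_⟩
      convert hmul _ _ _ _ _ _ ih hL using 1 <;> push_cast <;> ring
  obtain ⟨u', rfl⟩ : ∃ u' : ℕ, u = (u' + 1 : ℕ) := ⟨(u - 1).toNat, by push_cast; omega⟩
  obtain ⟨v', rfl⟩ : ∃ v' : ℕ, v = (v' + 1 : ℕ) := ⟨(v - 1).toNat, by push_cast; omega⟩
  obtain ⟨n, h, hX⟩ := pow _ _ _ hX u'
  obtain ⟨m, g, hY⟩ := pow _ _ _ hY v'
  set D : ℤ := ((u' + 1 : ℕ) : ℤ) * ((v' + 1 : ℕ) : ℤ) with hD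
  have hDpos : 0 < D := by positivity
  have e : ((v' + 1 : ℕ) : ℤ) * (-((u' + 1 : ℕ) : ℤ)) = -D := by rw [hD]; ring
  rw [e] at hY
  have hKD : 1 ≤ K * D := by have := mul_pos hK hDpos; omega
  -- start
  have hXY := hmul _ _ _ _ _ _ hX hY
  rw [add_neg_cancel] at hXY
  obtain ⟨N0, hN0, hW⟩ := pow0 _ _ hXY (h + g).natAbs
  set w0 : ℤ := (((h + g).natAbs + 1 : ℕ) : ℤ) * (h + g + m * K * D) with hw0
  have up : ∀ t : ℕ, ∃ (N : ℕ) (w : ℤ), (h + g).natAbs + 1 ≤ N ∧ w0 + t ≤ w ∧ L N 0 w := by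
    intro t
    induction t with
    | zero => exact ⟨N0, w0, hN0, by simp, hW⟩
    | succ t ih =>
      obtain ⟨N, w, h1, h2, h3⟩ := ih
      have h4 := hmul _ _ _ _ _ _ hX (hmul _ _ _ _ _ _ h3 hY)
      refine ⟨n + (N + m), _, by omega, ?_, by simpa using h4⟩
      have h5 : ((N + m : ℕ) : ℤ) ≤ ((N + m : ℕ) : ℤ) * K * D := by
        rw [mul_assoc]; nlinarith
      push_cast at h5 ⊢
      omega
  have down : ∀ t : ℕ, ∃ (N : ℕ) (w : ℤ), (h + g).natAbs + 1 ≤ N ∧ w ≤ w0 - t ∧ L N 0 w := by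
    intro t
    induction t with
    | zero => exact ⟨N0, w0, hN0, by simp, hW⟩
    | succ t ih =>
      obtain ⟨N, w, h1, h2, h3⟩ := ih
      have h4 := hmul _ _ _ _ _ _ hY (hmul _ _ _ _ _ _ h3 hX)
      refine ⟨m + (N + n), _, by omega, ?_, by simpa using h4⟩
      have h5 : ((N + n : ℕ) : ℤ) ≤ ((N + n : ℕ) : ℤ) * K * D := by
        rw [mul_assoc]; nlinarith
      push_cast at h5 ⊢
      omega
  obtain ⟨N1, p, -, hp, hP⟩ := up (w0.natAbs + 1)
  obtain ⟨N2, q, -, hq, hQ⟩ := down (w0.natAbs + 1)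
  have hp1 : 1 ≤ p := by clear_value w0; omega
  have hq1 : q ≤ -1 := by clear_value w0; omega
  clear hp hq
  obtain ⟨p', rfl⟩ : ∃ p' : ℕ, p = (p' + 1 : ℕ) := ⟨(p - 1).toNat, by push_cast; omega⟩
  obtain ⟨q', rfl⟩ : ∃ q' : ℕ, q = -((q' + 1 : ℕ) : ℤ) :=
    ⟨(-q - 1).toNat, by push_cast; omega⟩
  obtain ⟨M1, -, hP⟩ := pow0 _ _ hP q'
  obtain ⟨M2, -, hQ⟩ := pow0 _ _ hQ p'
  refine ⟨M1 + M2, ?_⟩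
  convert hmul _ _ _ _ _ _ hP hQ using 1 <;> push_cast <;> ring

theorem Good.zero_loop {F : ℂ ≃ₜ ℂ} {K : ℤ} (h : Good F K)
    (hup : ∀ N : ℕ, 1 ≤ N → ∃ z, ((F^[N] z).im - z.im) ≤ 0)
    (hdn : ∀ N : ℕ, 1 ≤ N → ∃ z, 0 ≤ ((F^[N] z).im - z.im)) {ε : ℝ} (hε : 0 < ε) (x : ℂ) :
    ∃ n, Ch F ε n x x := by
  obtain ⟨m, g, u, hu, hY⟩ := h.loop_sign (Or.inl rfl) (by simpa using hup) hε x
  obtain ⟨n, a, v, hv, hX⟩ := h.loop_sign (s := -1) (Or.inr rfl) (by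
    intro N hN
    obtain ⟨z, hz⟩ := hdn N hN
    exact ⟨z, by linarith⟩) hε x
  have hu' : u < 0 := by
    have : (u : ℝ) < 0 := by linarith
    exact_mod_cast this
  have hv' : 0 < v := by
    have : (0 : ℝ) < v := by linarith
    exact_mod_cast this
  obtain ⟨N, hN⟩ := heis (L := fun n v h => Ch F ε n x (x + (h : ℤ) + (v : ℤ) * I)) (K := K) h.pos
    (fun n v h hL => hL.pos)
    (by
      intro n v b n' v' b' h1 h2
      have := h1.trans (h2.lat h.toTw b v)
      convert this using 1
      push_cast; ring) (u := -u) hv' (by omega) hX (by simpa using hY)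
  exact ⟨N, by simpa using hN⟩

theorem Good.two_loop {F : ℂ ≃ₜ ℂ} {K : ℤ} (h : Good F K)
    (hup : ∀ N : ℕ, 1 ≤ N → ∃ z, ((F^[N] z).im - z.im) ≤ 0)
    (hdn : ∀ N : ℕ, 1 ≤ N → ∃ z, 0 ≤ ((F^[N] z).im - z.im)) {ε : ℝ} (hε : 0 < ε) (x : ℂ) :
    ∃ m : ℕ, Ch F ε (2 ^ m) x x := by
  have hQ : ∃ s : ℕ, 1 ≤ s ∧ ∀ j : ℕ, Ch F ε ((j + 1) * s) (F x) x := by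
    refine PreconnectedSpace.induction₂'
      (fun y y' : ℂ => ∃ s : ℕ, 1 ≤ s ∧ ∀ j : ℕ, Ch F ε ((j + 1) * s) y y') ?_ ?_ (F x) x
    · intro y
      obtain ⟨n, hn⟩ := h.zero_loop hup hdn hε y
      have hloop : ∀ j : ℕ, Ch F ε ((j + 1) * n) y y := by
        intro j
        induction j with
        | zero => simpa using hn
        | succ j ih =>
          have := ih.trans hn
          convert this using 1
          ring
      have h1 := hn.ev F.continuous
      have t1 : Filter.Tendsto (fun y' : ℂ => (y, y')) (nhds y) (nhds (y, y)) :=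
        (by fun_prop : Continuous fun y' : ℂ => (y, y')).tendsto y
      have t2 : Filter.Tendsto (fun y' : ℂ => (y', y)) (nhds y) (nhds (y, y)) :=
        (by fun_prop : Continuous fun y' : ℂ => (y', y)).tendsto y
      filter_upwards [t1.eventually h1, t2.eventually h1] with y' c1 c2
      refine ⟨⟨n, hn.pos, fun j => ?_⟩, ⟨n, hn.pos, fun j => ?_⟩⟩
      · rcases j with _ | j
        · simpa using c1
        · have := (hloop j).trans c1
          convert this using 1
          ring
      · rcases j with _ | j
        · simpa using c2
        · have := c2.trans (hloop j)
          convert this using 1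
          ring
    · refine ⟨?_⟩
      rintro y y' y'' ⟨s, hs, h1⟩ ⟨s', hs', h2⟩
      refine ⟨s + s', by omega, fun j => ?_⟩
      have := (h1 j).trans (h2 j)
      convert this using 1
      ring
  obtain ⟨s, hs, hj⟩ := hQ
  have hl : ∀ j : ℕ, Ch F ε ((j + 1) * s + 1) x x := fun j =>
    Ch.cons (u := F x) (by simpa using hε) (hj j)
  have hl2 : ∀ t J : ℕ, t ≤ J → Ch F ε (t + 1 + (J + 1) * s) x x := by
    intro t
    induction t with
    | zero =>
      intro J _
      convert hl J using 1
      ring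
    | succ t ih =>
      intro J hJ
      obtain ⟨J', rfl⟩ : ∃ J', J = J' + 1 := ⟨J - 1, by omega⟩
      have := (ih J' (by omega)).trans (hl 0)
      convert this using 1
      ring
  refine ⟨s * s + s, ?_⟩
  have h1 : s * s + s < 2 ^ (s * s + s) := Nat.lt_two_pow_self
  set M := 2 ^ (s * s + s) with hM
  have h2 : (M - 1) % s < s := Nat.mod_lt _ hs
  have h3 : s ≤ (M - 1) / s := by
    rw [Nat.le_div_iff_mul_le hs]; omega
  have h4 := Nat.mod_add_div (M - 1) s
  convert hl2 ((M - 1) % s) ((M - 1) / s - 1) (by omega) using 1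
  rw [Nat.sub_add_cancel (by omega), mul_comm]
  omega

end MinTwist
end

noncomputable section
open MeasureTheory

namespace MinTwist
open Complex

theorem Good.disp {F : ℂ ≃ₜ ℂ} {K : ℤ} (h : Good F K) : ∃ δ : ℝ, 0 < δ ∧ ∀ z, δ ≤ ‖F z - z‖ := by
  have hne : ∀ z, F z ≠ z := by
    intro z hz
    refine h.no_bdd z 0 (fun n => ?_)
    have : F^[n] z = z := Function.iterate_fixed hz n
    simp [this]
  obtain ⟨B, hB, hb⟩ := h.bdd
  have hc : IsCompact (Set.Icc (0 : ℝ) 1 ×ℂ Set.Icc (-(B + 1)) (B + 1)) :=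
    isCompact_Icc.reProdIm isCompact_Icc
  have hFc := F.continuous
  obtain ⟨w, hw, hmin⟩ := hc.exists_isMinOn
    ⟨0, by
      rw [mem_reProdIm]; simp; constructor <;> linarith⟩
    (f := fun z => ‖F z - z‖) (by fun_prop)
  refine ⟨Min.min 1 ‖F w - w‖, lt_min one_pos (norm_pos_iff.2 (sub_ne_zero.2 (hne w))), fun z => ?_⟩
  by_cases hz : |z.im| ≤ B + 1
  · refine (min_le_right _ _).trans ?_
    have e : ‖F z - z‖ = ‖F (z + ((-⌊z.re⌋ : ℤ) : ℂ)) - (z + ((-⌊z.re⌋ : ℤ) : ℂ))‖ := by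
      rw [h.hor_int]; congr 1; ring
    rw [e]
    apply hmin
    rw [mem_reProdIm]
    rw [abs_le] at hz
    have h1 := Int.floor_le z.re
    have h2 := Int.lt_floor_add_one z.re
    refine ⟨⟨?_, ?_⟩, ⟨?_, ?_⟩⟩ <;> simp <;> linarith
  · refine (min_le_left _ _).trans ?_
    have h1 := hb z
    have hK : (1 : ℝ) ≤ K := by exact_mod_cast h.pos
    have h2 : ‖((K * z.im : ℝ) : ℂ)‖ ≤ ‖F z - z‖ + ‖F z - z - (K * z.im : ℝ)‖ := by
      have := norm_sub_le (F z - z) (F z - z - (K * z.im : ℝ))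
      rwa [sub_sub_cancel] at this
    rw [norm_real, Real.norm_eq_abs, abs_mul, abs_of_pos (by linarith : (0 : ℝ) < K)] at h2
    nlinarith [abs_nonneg z.im]

theorem Ch.seq {F : ℂ → ℂ} {ε : ℝ} {n : ℕ} {z w : ℂ} (h : Ch F ε n z w) :
    ∃ x : ℕ → ℂ, x 0 = z ∧ x n = w ∧ ∀ i < n, dist (F (x i)) (x (i + 1)) < ε := by
  induction h with
  | @one z w h =>
    refine ⟨fun i => if i = 0 then z else w, by simp, by simp, ?_⟩
    intro i hi
    obtain rfl : i = 0 := by omega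
    simpa using h
  | @cons n z u w h hc ih =>
    obtain ⟨x, x0, xn, hx⟩ := ih
    refine ⟨fun i => if i = 0 then z else x (i - 1), by simp, by simpa using xn, ?_⟩
    intro i hi
    rcases i with _ | i
    · simpa [x0] using h
    · simpa using hx i (by omega)

theorem dense_re (c : ℝ) : Dense {w : ℂ | w.re ≠ c} := by
  rw [Metric.dense_iff]
  intro x r hr
  by_cases hx : x.re = c
  · refine ⟨x + (r / 2 : ℝ), ?_, ?_⟩
    · rw [Metric.mem_ball, dist_eq_norm, add_sub_cancel_left, norm_real, Real.norm_eq_abs,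
        abs_of_pos (by linarith)]
      linarith
    · have : (x + (r / 2 : ℝ)).re ≠ c := by
        rw [add_re, ofReal_re, hx]; linarith
      exact this
  · exact ⟨x, Metric.mem_ball_self hr, hx⟩

theorem dense_im (c : ℝ) : Dense {w : ℂ | w.im ≠ c} := by
  rw [Metric.dense_iff]
  intro x r hr
  by_cases hx : x.im = c
  · refine ⟨x + (r / 2 : ℝ) * I, ?_, ?_⟩
    · rw [Metric.mem_ball, dist_eq_norm, add_sub_cancel_left, norm_mul, norm_I, mul_one, norm_real,
        Real.norm_eq_abs, abs_of_pos (by linarith)]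
      linarith
    · have : (x + (r / 2 : ℝ) * I).im ≠ c := by
        rw [add_im, hx, im_ofReal_mul, I_im]; linarith
      exact this
  · exact ⟨x, Metric.mem_ball_self hr, hx⟩

theorem perturb (F : ℂ ≃ₜ ℂ) (x : ℕ → ℂ) {η : ℝ} (hη : 0 < η) (n : ℕ) :
    ∃ y : ℕ → ℂ, (∀ i < n, dist (y i) (x i) < η) ∧
      ∀ i j, i < j → j < n → (y j).re ≠ (y i).re ∧ (F (y j)).im ≠ (F (y i)).im := by
  induction n with
  | zero => exact ⟨x, by simp, by simp⟩
  | succ n ih =>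
    obtain ⟨y, h1, h2⟩ := ih
    have hd : Dense (⋂ i : ℕ, ({w : ℂ | w.re ≠ (y i).re} ∩ F ⁻¹' {w : ℂ | w.im ≠ (F (y i)).im})) := by
      have o1 : ∀ c : ℝ, IsOpen {w : ℂ | w.re ≠ c} := fun c =>
        isOpen_ne_fun continuous_re continuous_const
      have o2 : ∀ c : ℝ, IsOpen {w : ℂ | w.im ≠ c} := fun c =>
        isOpen_ne_fun continuous_im continuous_const
      apply dense_iInter_of_isOpen
      · intro i
        exact (o1 _).inter ((o2 _).preimage F.continuous)
      · intro i
        exact (dense_re _).inter_of_isOpen_left ((dense_im _).preimage F.isOpenMap) (o1 _)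
    obtain ⟨w, hw1, hw2⟩ := hd.exists_dist_lt (x n) hη
    rw [Set.mem_iInter] at hw1
    refine ⟨Function.update y n w, ?_, ?_⟩
    · intro i hi
      by_cases hin : i = n
      · subst hin; rw [Function.update_self, dist_comm]; exact hw2
      · rw [Function.update_of_ne hin]; exact h1 i (by omega)
    · intro i j hij hj
      rw [Function.update_of_ne (by omega : i ≠ n)]
      by_cases hjn : j = n
      · subst hjn; rw [Function.update_self]; exact hw1 i
      · rw [Function.update_of_ne hjn]; exact h2 i j hij (by omega)

theorem interp (n : ℕ) (a c : ℕ → ℝ) (ha : ∀ i j, i < j → j < n → a j ≠ a i) {ε : ℝ} (hε : 0 < ε)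
    (hc : ∀ i < n, |c i| ≤ ε) :
    ∃ ψ : ℝ → ℝ, Continuous ψ ∧ (∀ t, |ψ t| ≤ ε) ∧ ∀ i < n, ψ (a i) = c i := by
  have hinj : Set.InjOn a (Finset.range n : Set ℕ) := by
    intro i hi j hj hij
    simp only [Finset.coe_range, Set.mem_Iio] at hi hj
    rcases lt_trichotomy i j with h | h | h
    · exact absurd hij.symm (ha i j h hj)
    · exact h
    · exact absurd hij (ha j i h hi)
  refine ⟨fun t => max (-ε) (min ε ((Lagrange.interpolate (Finset.range n) a c).eval t)), ?_, ?_, ?_⟩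
  · have := (Lagrange.interpolate (Finset.range n) a c).continuous
    fun_prop
  · intro t
    rw [abs_le]
    exact ⟨le_max_left _ _, max_le (by linarith) (min_le_left _ _)⟩
  · intro i hi
    simp only
    rw [Lagrange.eval_interpolate_at_node c hinj (Finset.mem_range.2 hi)]
    have := abs_le.1 (hc i hi)
    rw [min_eq_right this.2, max_eq_right this.1]

theorem Good.no_two_loop {F : ℂ ≃ₜ ℂ} {K : ℤ} (h : Good F K) {ε : ℝ} (hε : 0 < ε)
    (hd : ∀ z, 2 * ε < ‖F z - z‖) (m : ℕ) (z : ℂ) (hl : Ch F ε (2 ^ m) z z) : False := by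
  obtain ⟨x, x0, xn, hx⟩ := hl.seq
  have hnpos : 0 < 2 ^ m := by positivity
  set n := 2 ^ m with hn
  have hx' : ∀ i < n, dist (F (x i)) (x ((i + 1) % n)) < ε := by
    intro i hi
    rcases Nat.lt_or_ge (i + 1) n with h1 | h1
    · rw [Nat.mod_eq_of_lt h1]; exact hx i hi
    · have h2 : i + 1 = n := by omega
      have := hx i hi
      rw [h2, Nat.mod_self, x0]
      rwa [h2, xn] at this
  have hη : ∃ η : ℝ, 0 < η ∧ ∀ i < n, ∀ p q : ℂ, dist p (x i) < η →
      dist q (x ((i + 1) % n)) < η → dist (F p) q < ε := by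
    have hev : ∀ i ∈ Finset.range n, ∀ᶠ η : ℝ in nhdsWithin 0 (Set.Ioi 0), ∀ p q : ℂ,
        dist p (x i) < η → dist q (x ((i + 1) % n)) < η → dist (F p) q < ε := by
      intro i hi
      have ho : IsOpen {p : ℂ × ℂ | dist (F p.1) p.2 < ε} :=
        isOpen_lt (by have := F.continuous; fun_prop) continuous_const
      obtain ⟨r, hr, hball⟩ := Metric.isOpen_iff.1 ho (x i, x ((i + 1) % n))
        (hx' i (Finset.mem_range.1 hi))
      filter_upwards [Ioo_mem_nhdsGT hr] with η hη p q hp hq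
      have : (p, q) ∈ Metric.ball (x i, x ((i + 1) % n)) r := by
        rw [Metric.mem_ball, Prod.dist_eq]
        exact max_lt (hp.trans hη.2) (hq.trans hη.2)
      exact hball this
    have := ((Filter.eventually_all_finset _).2 hev).and self_mem_nhdsWithin
    obtain ⟨η, h1, h2⟩ := this.exists
    exact ⟨η, h2, fun i hi => h1 i (Finset.mem_range.2 hi)⟩
  obtain ⟨η, hη, hy⟩ := hη
  obtain ⟨y, y1, y2⟩ := perturb F x hη n
  have hY : ∀ i < n, dist (F (y i)) (y ((i + 1) % n)) < ε := fun i hi =>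
    hy i hi _ _ (y1 i hi) (y1 _ (Nat.mod_lt _ hnpos))
  have hYr : ∀ i < n, |(y ((i + 1) % n)).re - (F (y i)).re| ≤ ε := by
    intro i hi
    rw [← sub_re]
    refine (abs_re_le_norm _).trans ?_
    rw [← dist_eq_norm, dist_comm]
    exact (hY i hi).le
  have hYi : ∀ i < n, |(y ((i + 1) % n)).im - (F (y i)).im| ≤ ε := by
    intro i hi
    rw [← sub_im]
    refine (abs_im_le_norm _).trans ?_
    rw [← dist_eq_norm, dist_comm]
    exact (hY i hi).le
  obtain ⟨ψ, ψ1, ψ2, ψ3⟩ := interp n (fun i => (F (y i)).im)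
    (fun i => (y ((i + 1) % n)).re - (F (y i)).re) (fun i j hij hj => (y2 i j hij hj).2) hε hYr
  -- second interpolation, indexed by the target
  obtain ⟨χ, χ1, χ2, χ3⟩ := interp n (fun i => (y i).re)
    (fun i => (y i).im - (F (y ((i + n - 1) % n))).im)
    (fun i j hij hj => (y2 i j hij hj).1) hε (by
      intro i hi
      have h1 := hYi ((i + n - 1) % n) (Nat.mod_lt _ hnpos)
      have e : ((i + n - 1) % n + 1) % n = i := by
        rw [Nat.mod_add_mod, Nat.sub_add_cancel (by omega), Nat.add_mod_right, Nat.mod_eq_of_lt hi]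
      rw [e] at h1
      simpa using h1)
  set H : ℂ → ℂ := fun w => (w + (ψ w.im : ℝ)) + (χ (w + (ψ w.im : ℝ)).re : ℝ) * I with hH
  have hG : GG (fun z => H (F z)) :=
    GG.comp (G := H) (GG.comp (GG.vshear χ χ1) (GG.hshear ψ ψ1)) h.gg
  have hHd : ∀ w, ‖H w - w‖ ≤ 2 * ε := by
    intro w
    have e : H w - w = (ψ w.im : ℝ) + (χ (w + (ψ w.im : ℝ)).re : ℝ) * I := by rw [hH]; ring
    rw [e]
    refine (norm_add_le _ _).trans ?_
    rw [norm_mul, norm_I, mul_one, norm_real, norm_real]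
    have a1 := ψ2 w.im
    have a2 := χ2 (w + (ψ w.im : ℝ)).re
    rw [Real.norm_eq_abs, Real.norm_eq_abs]
    linarith
  have hfp : ∀ z, H (F z) ≠ z := by
    intro z hz
    have a1 := hHd (F z)
    rw [hz, norm_sub_rev] at a1
    linarith [hd z]
  have hGy : ∀ i < n, H (F (y i)) = y ((i + 1) % n) := by
    intro i hi
    have hj : (i + 1) % n < n := Nat.mod_lt _ hnpos
    have e : ((i + 1) % n + n - 1) % n = i := by
      rcases Nat.lt_or_ge (i + 1) n with h1 | h1
      · rw [Nat.mod_eq_of_lt h1, show i + 1 + n - 1 = i + n by omega, Nat.add_mod_right,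
          Nat.mod_eq_of_lt hi]
      · have h2 : i + 1 = n := by omega
        rw [h2, Nat.mod_self, Nat.zero_add, Nat.mod_eq_of_lt (by omega)]
        omega
    have a1 := ψ3 i hi
    have a2 := χ3 _ hj
    rw [e] at a2
    have e2 : (F (y i) + (ψ (F (y i)).im : ℝ)).re = (y ((i + 1) % n)).re := by
      rw [add_re, ofReal_re, a1]; ring
    simp only [hH]
    rw [e2, a2, a1]
    apply Complex.ext <;> simp
  have hit : ∀ i, (fun z => H (F z))^[i] (y 0) = y (i % n) := by
    intro i
    induction i with
    | zero => simp
    | succ i ih =>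
      rw [Function.iterate_succ_apply', ih, hGy _ (Nat.mod_lt _ hnpos), Nat.mod_add_mod]
  refine (hG.pow_two hfp m).2 (y 0) ?_
  rw [hit, ← hn, Nat.mod_self]

theorem Good.dichotomy {F : ℂ ≃ₜ ℂ} {K : ℤ} (h : Good F K) :
    (∃ N : ℕ, 1 ≤ N ∧ ∀ z, z.im < (F^[N] z).im) ∨ (∃ N : ℕ, 1 ≤ N ∧ ∀ z, (F^[N] z).im < z.im) := by
  by_contra hcon
  push Not at hcon
  obtain ⟨δ, hδ, hd⟩ := h.disp
  have hε : 0 < δ / 4 := by positivity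
  obtain ⟨m, hm⟩ := h.two_loop
    (fun N hN => by
      obtain ⟨z, hz⟩ := hcon.1 N hN
      exact ⟨z, by linarith⟩)
    (fun N hN => by
      obtain ⟨z, hz⟩ := hcon.2 N hN
      exact ⟨z, by linarith⟩) hε 0
  exact h.no_two_loop hε (fun z => by linarith [hd z]) m 0 hm

end MinTwist
end

noncomputable section
open MeasureTheory

namespace MinTwist
open Complex

theorem exists_iter_homeo (Φ : ℂ ≃ₜ ℂ) (q : ℕ) : ∃ H : ℂ ≃ₜ ℂ, ∀ z, H z = Φ^[q] z := by
  induction q with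
  | zero => exact ⟨Homeomorph.refl ℂ, fun z => rfl⟩
  | succ q ih =>
    obtain ⟨H, hH⟩ := ih
    exact ⟨Φ.trans H, fun z => by
      rw [Homeomorph.trans_apply, hH, Function.iterate_succ_apply]⟩

theorem Good.power {Φ : ℂ ≃ₜ ℂ} {k : ℤ} (h : Good Φ k) (q : ℕ) (hq : 1 ≤ q) (p : ℤ) :
    ∃ H : ℂ ≃ₜ ℂ, (∀ z, H z = Φ^[q] z - p * I) ∧ Good H (q * k) := by
  obtain ⟨H0, hH0⟩ := exists_iter_homeo Φ q
  have hH : ∀ z, (H0.trans (Homeomorph.addRight (-(p * I)))) z = Φ^[q] z - p * I := by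
    intro z
    rw [Homeomorph.trans_apply, hH0]
    simp [sub_eq_add_neg]
  refine ⟨H0.trans (Homeomorph.addRight (-(p * I))), hH, ⟨⟨?_, ?_, ?_⟩, ?_⟩⟩
  · have := h.pos
    have h2 : (0 : ℤ) < q := by exact_mod_cast hq
    positivity
  · intro z
    rw [hH, hH]
    have := h.iter_hor q z 1
    push_cast at this
    rw [this]; ring
  · intro z
    rw [hH, hH]
    have := h.iter_lat q z 0 1
    push_cast at this
    rw [show z + I = z + 0 + 1 * I by ring, this]
    push_cast; ring
  · intro E hE hne hlat hfw
    have hfw' : ∀ z ∈ E, Φ^[q] z ∈ E := by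
      intro z hz
      have h1 := hfw z hz
      rw [hH] at h1
      have h2 := hlat _ h1 0 p
      convert h2 using 1
      push_cast; ring
    haveI : NeZero q := ⟨by omega⟩
    have := count_trick h.min (fun i : Fin q => {z : ℂ | Φ^[(i : ℕ)] z ∈ E})
      (fun i => hE.preimage (Φ.continuous.iterate i))
      (locallyFinite_of_finite _)
      (fun i => i - 1) (sub_left_injective)
      (by
        intro z i hz
        have hz' : Φ^[(i : ℕ)] z ∈ E := hz
        change Φ^[((i - 1 : Fin q) : ℕ)] (Φ z) ∈ E
        rw [← Function.iterate_succ_apply]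
        by_cases hi : i = 0
        · subst hi
          have e : ((0 - 1 : Fin q) : ℕ).succ = q := by
            obtain ⟨q', rfl⟩ : ∃ q', q = q' + 1 := ⟨q - 1, by omega⟩
            simp [Fin.coe_neg_one]
          rw [e]
          exact hfw' _ hz'
        · have e : ((i - 1 : Fin q) : ℕ).succ = i := by
            rw [Fin.val_sub_one_of_ne_zero hi]
            have : (i : ℕ) ≠ 0 := fun h0 => hi (Fin.ext (by simpa using h0))
            omega
          rw [e]
          exact hz')
      (by
        intro a b
        refine ⟨id, Function.injective_id, fun z i hz => ?_⟩
        change Φ^[(i : ℕ)] (z + a + b * I) ∈ E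
        rw [h.iter_lat]
        exact hlat _ hz _ _) 0 (by simpa using hne)
    simpa using this

theorem Good.dich {Φ : ℂ ≃ₜ ℂ} {k : ℤ} (h : Good Φ k) (q : ℕ) (hq : 1 ≤ q) (p : ℤ) :
    (∃ N : ℕ, 1 ≤ N ∧ ∀ z, N * p < (Φ^[q * N] z).im - z.im) ∨
    (∃ N : ℕ, 1 ≤ N ∧ ∀ z, (Φ^[q * N] z).im - z.im < N * p) := by
  obtain ⟨H, hH, hg⟩ := h.power q hq p
  have hit : ∀ N z, ∃ a : ℤ, H^[N] z = Φ^[q * N] z + a + ((-(N * p) : ℤ) : ℂ) * I := by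
    intro N z
    induction N with
    | zero => exact ⟨0, by simp⟩
    | succ N ih =>
      obtain ⟨a, ha⟩ := ih
      rw [Function.iterate_succ_apply', ha, hH, h.iter_lat, ← Function.iterate_add_apply]
      refine ⟨a + q * k * (-(N * p)), ?_⟩
      rw [show q + q * N = q * (N + 1) by ring]
      push_cast; ring
  have him : ∀ N z, (H^[N] z).im = (Φ^[q * N] z).im - N * p := by
    intro N z
    obtain ⟨a, ha⟩ := hit N z
    rw [ha]; simp
    ring
  rcases hg.dichotomy with ⟨N, hN, hz⟩ | ⟨N, hN, hz⟩
  · exact Or.inl ⟨N, hN, fun z => by have := hz z; rw [him] at this; linarith⟩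
  · exact Or.inr ⟨N, hN, fun z => by have := hz z; rw [him] at this; linarith⟩

theorem birkhoff_low (φ : ℂ → ℝ) (T : ℂ → ℂ) (d : ℝ) (hd0 : 0 ≤ d)
    (hd : ∀ z, |φ (T z) - φ z| ≤ d)
    (M : ℕ) (hM : 1 ≤ M) (b : ℝ) (hb : ∀ z, b ≤ φ (T^[M] z) - φ z) :
    ∃ A, ∀ (n : ℕ) z, n * (b / M) - A ≤ φ (T^[n] z) - φ z := by
  have hM0 : (0 : ℝ) < M := by exact_mod_cast hM
  have h1 : ∀ (n : ℕ) z, -(n * d) ≤ φ (T^[n] z) - φ z := by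
    intro n z
    induction n with
    | zero => simp
    | succ n ih =>
      rw [Function.iterate_succ_apply']
      have := (abs_le.1 (hd (T^[n] z))).1
      push_cast; linarith
  have h2 : ∀ (j : ℕ) z, j * b ≤ φ (T^[M * j] z) - φ z := by
    intro j z
    induction j with
    | zero => simp
    | succ j ih =>
      rw [show M * (j + 1) = M + M * j by ring, Function.iterate_add_apply]
      have := hb (T^[M * j] z)
      push_cast; linarith
  refine ⟨|b| + M * d, fun n z => ?_⟩
  have e := Nat.mod_add_div n M
  have hr : n % M < M := Nat.mod_lt _ hM
  have h3 := h1 (n % M) (T^[M * (n / M)] z)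
  rw [← Function.iterate_add_apply, e] at h3
  have h4 := h2 (n / M) z
  have e' : (n : ℝ) = (n % M : ℕ) + M * (n / M : ℕ) := by exact_mod_cast e.symm
  set r : ℝ := ((n % M : ℕ) : ℝ)
  set j : ℝ := ((n / M : ℕ) : ℝ)
  have hr0 : 0 ≤ r := Nat.cast_nonneg _
  have hr1 : r ≤ M := Nat.cast_le.2 hr.le
  have h5 : n * (b / M) = j * b + (r / M) * b := by rw [e']; field_simp; ring
  have h6 : (r / M) * b ≤ |b| := by
    have h7 : r / M ≤ 1 := (div_le_one hM0).2 hr1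
    have h8 : 0 ≤ r / M := by positivity
    nlinarith [le_abs_self b, abs_nonneg b]
  have h7 : r * d ≤ M * d := by gcongr
  rw [h5]
  linarith

/-- The set of displacement averages of length `n`. -/
def avg (Φ : ℂ → ℂ) (n : ℕ) : Set ℝ := {r : ℝ | ∃ z : ℂ, r = ((Φ^[n] z).im - z.im) / n}

/-- The rotation set expressed in the plane. -/
def rotP (Φ : ℂ → ℂ) : Set ℝ := ⋂ i : ℕ, closure (⋃ n : ℕ, ⋃ _ : i + 1 ≤ n, avg Φ n)

theorem Tw.dbdd {Φ : ℂ ≃ₜ ℂ} {k : ℤ} (h : Tw Φ k) :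
    ∃ d : ℝ, 0 ≤ d ∧ ∀ z, |(Φ z).im - z.im| ≤ d := by
  have := Φ.continuous
  obtain ⟨d, h0, hd⟩ := bdd_of_periodic (fun z => (Φ z).im - z.im) (by fun_prop)
    (by intro z a b; rw [h.lat]; simp)
  exact ⟨d, h0, hd⟩

theorem rotP_lower {Φ : ℂ → ℂ} {c c' A : ℝ} (hcc : c < c')
    (hA : ∀ (n : ℕ) z, n * c' - A ≤ (Φ^[n] z).im - z.im) : ∀ r ∈ rotP Φ, c < r := by
  intro r hr
  obtain ⟨m, hm⟩ := exists_nat_gt (|A| / ((c' - c) / 2))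
  have hpos : 0 < (c' - c) / 2 := by linarith
  have h1 := Set.mem_iInter.1 hr m
  have h2 : closure (⋃ n : ℕ, ⋃ _ : m + 1 ≤ n, avg Φ n) ⊆ Set.Ici ((c + c') / 2) := by
    apply closure_minimal _ isClosed_Ici
    intro t ht
    simp only [Set.mem_iUnion] at ht
    obtain ⟨n, hn, z, rfl⟩ := ht
    have hn1 : (m : ℝ) + 1 ≤ n := by exact_mod_cast hn
    have hm0 : (0 : ℝ) ≤ m := Nat.cast_nonneg m
    have hn0 : (0 : ℝ) < n := by linarith
    rw [Set.mem_Ici, le_div_iff₀ hn0]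
    rw [div_lt_iff₀ hpos] at hm
    have h3 := hA n z
    have h4 := le_abs_self A
    have h5 : (m : ℝ) * ((c' - c) / 2) ≤ n * ((c' - c) / 2) :=
      mul_le_mul_of_nonneg_right (by linarith) hpos.le
    linarith
  have := h2 h1
  rw [Set.mem_Ici] at this
  linarith

theorem rotP_upper {Φ : ℂ → ℂ} {c c' A : ℝ} (hcc : c' < c)
    (hA : ∀ (n : ℕ) z, (Φ^[n] z).im - z.im ≤ n * c' + A) : ∀ r ∈ rotP Φ, r < c := by
  intro r hr
  obtain ⟨m, hm⟩ := exists_nat_gt (|A| / ((c - c') / 2))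
  have hpos : 0 < (c - c') / 2 := by linarith
  have h1 := Set.mem_iInter.1 hr m
  have h2 : closure (⋃ n : ℕ, ⋃ _ : m + 1 ≤ n, avg Φ n) ⊆ Set.Iic ((c + c') / 2) := by
    apply closure_minimal _ isClosed_Iic
    intro t ht
    simp only [Set.mem_iUnion] at ht
    obtain ⟨n, hn, z, rfl⟩ := ht
    have hn1 : (m : ℝ) + 1 ≤ n := by exact_mod_cast hn
    have hm0 : (0 : ℝ) ≤ m := Nat.cast_nonneg m
    have hn0 : (0 : ℝ) < n := by linarith
    rw [Set.mem_Iic, div_le_iff₀ hn0]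
    rw [div_lt_iff₀ hpos] at hm
    have h3 := hA n z
    have h4 := le_abs_self A
    have h5 : (m : ℝ) * ((c - c') / 2) ≤ n * ((c - c') / 2) :=
      mul_le_mul_of_nonneg_right (by linarith) hpos.le
    linarith
  have := h2 h1
  rw [Set.mem_Iic] at this
  linarith

theorem Good.rot_side {Φ : ℂ ≃ₜ ℂ} {k : ℤ} (h : Good Φ k) (x : ℚ) :
    (∀ r ∈ rotP Φ, (x : ℝ) < r) ∨ (∀ r ∈ rotP Φ, r < (x : ℝ)) := by
  obtain ⟨d, hd0, hd⟩ := h.dbdd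
  have hq : 1 ≤ x.den := x.den_pos
  have hq0 : (0 : ℝ) < x.den := by exact_mod_cast hq
  have hx : (x : ℝ) = x.num / x.den := by exact_mod_cast (Rat.num_div_den x).symm
  have per : ∀ (n : ℕ) z (a b : ℤ), (Φ^[n] (z + a + b * I)).im - (z + a + b * I).im
      = (Φ^[n] z).im - z.im := by
    intro n z a b
    rw [h.iter_lat]; simp
  have hne : sq.Nonempty := ⟨0, by rw [sq_mem]; simp⟩
  rcases h.dich x.den hq x.num with ⟨N, hN, hz⟩ | ⟨N, hN, hz⟩
  · left
    have hN0 : (0 : ℝ) < N := by exact_mod_cast hN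
    have hc := Φ.continuous.iterate (x.den * N)
    obtain ⟨w, hw, hmin⟩ := isCompact_sq.exists_isMinOn hne
      (f := fun z => (Φ^[x.den * N] z).im - z.im) (by fun_prop)
    obtain ⟨A, hA⟩ := birkhoff_low (fun z => z.im) Φ d hd0 hd (x.den * N) (by nlinarith)
      ((Φ^[x.den * N] w).im - w.im) (by
        intro z
        obtain ⟨u, hu, a, b, rfl⟩ := exists_sq z
        rw [per]
        exact hmin hu)
    refine rotP_lower ?_ hA
    rw [hx]
    push_cast
    rw [div_lt_div_iff₀ hq0 (by positivity)]
    have := hz w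
    nlinarith
  · right
    have hN0 : (0 : ℝ) < N := by exact_mod_cast hN
    have hc := Φ.continuous.iterate (x.den * N)
    obtain ⟨w, hw, hmin⟩ := isCompact_sq.exists_isMaxOn hne
      (f := fun z => (Φ^[x.den * N] z).im - z.im) (by fun_prop)
    obtain ⟨A, hA⟩ := birkhoff_low (fun z => -z.im) Φ d hd0
      (fun z => by rw [← abs_neg]; convert hd z using 2; ring) (x.den * N) (by nlinarith)
      (-((Φ^[x.den * N] w).im - w.im)) (by
        intro z
        obtain ⟨u, hu, a, b, rfl⟩ := exists_sq z
        have h1 := per (x.den * N) u a b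
        have h2 : (Φ^[x.den * N] u).im - u.im ≤ (Φ^[x.den * N] w).im - w.im := hmin hu
        linarith)
    refine rotP_upper (c' := ((Φ^[x.den * N] w).im - w.im) / (x.den * N : ℕ)) (A := A) ?_ ?_
    · rw [hx]
      push_cast
      rw [div_lt_div_iff₀ (by positivity) hq0]
      have := hz w
      nlinarith
    · intro n z
      have := hA n z
      rw [neg_div] at this
      linarith

theorem Tw.rot_nonempty {Φ : ℂ ≃ₜ ℂ} {k : ℤ} (h : Tw Φ k) : (rotP Φ).Nonempty := by
  obtain ⟨d, hd0, hd⟩ := h.dbdd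
  have hb : ∀ (n : ℕ) z, |(Φ^[n] z).im - z.im| ≤ n * d := by
    intro n z
    induction n with
    | zero => simp
    | succ n ih =>
      rw [Function.iterate_succ_apply']
      have h1 := abs_le.1 (hd (Φ^[n] z))
      have h2 := abs_le.1 ih
      rw [abs_le]
      push_cast
      constructor <;> linarith
  have hsub : ∀ i : ℕ, closure (⋃ n : ℕ, ⋃ _ : i + 1 ≤ n, avg Φ n) ⊆ Set.Icc (-d) d := by
    intro i
    apply closure_minimal _ isClosed_Icc
    intro t ht
    simp only [Set.mem_iUnion] at ht
    obtain ⟨n, hn, z, rfl⟩ := ht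
    have hn0 : (0 : ℝ) < n := by exact_mod_cast (by omega : 0 < n)
    have h2 := abs_le.1 (hb n z)
    constructor
    · rw [le_div_iff₀ hn0]; linarith
    · rw [div_le_iff₀ hn0]; linarith
  apply IsCompact.nonempty_iInter_of_sequence_nonempty_isCompact_isClosed
  · intro i
    apply closure_mono
    intro t ht
    simp only [Set.mem_iUnion] at ht ⊢
    obtain ⟨n, hn, h2⟩ := ht
    exact ⟨n, by omega, h2⟩
  · intro i
    refine Set.Nonempty.closure ⟨((Φ^[i + 1] 0).im - (0 : ℂ).im) / (i + 1 : ℕ), ?_⟩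
    simp only [Set.mem_iUnion]
    exact ⟨i + 1, le_rfl, 0, rfl⟩
  · exact isCompact_Icc.of_isClosed_subset isClosed_closure (hsub 0)
  · intro i
    exact isClosed_closure

theorem Good.rot {Φ : ℂ ≃ₜ ℂ} {k : ℤ} (h : Good Φ k) :
    ∃ α : ℝ, Irrational α ∧ rotP Φ = {α} := by
  obtain ⟨α, hα⟩ := h.rot_nonempty
  have hirr : ∀ r ∈ rotP Φ, ∀ s ∈ rotP Φ, ¬ r < s := by
    intro r hr s hs hrs
    obtain ⟨x, h1, h2⟩ := exists_rat_btwn hrs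
    rcases h.rot_side x with h3 | h3
    · linarith [h3 r hr]
    · linarith [h3 s hs]
  refine ⟨α, ?_, ?_⟩
  · rintro ⟨x, hx⟩
    rcases h.rot_side x with h3 | h3
    · linarith [h3 α hα]
    · linarith [h3 α hα]
  · apply Set.eq_singleton_iff_unique_mem.2 ⟨hα, fun r hr => ?_⟩
    exact le_antisymm (not_lt.1 (hirr α hα r hr)) (not_lt.1 (hirr r hr α hα))

end MinTwist
end


namespace MinTwist
open Complex

/-- The plane map conjugated to the complex plane. -/
def cF (L : DehnLift) : ℂ ≃ₜ ℂ :=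
  (equivRealProdCLM.toHomeomorph.trans L.F).trans equivRealProdCLM.toHomeomorph.symm

theorem cF_apply (L : DehnLift) (z : ℂ) :
    cF L z = (⟨(L.F (z.re, z.im)).1, (L.F (z.re, z.im)).2⟩ : ℂ) := by
  rfl

theorem cF_pair (L : DehnLift) (z : ℂ) : ((cF L z).re, (cF L z).im) = L.F (z.re, z.im) := by
  rw [cF_apply]

theorem cF_tw (L : DehnLift) : Tw (cF L) L.k := by
  refine ⟨L.k_pos, fun z => ?_, fun z => ?_⟩
  · rw [cF_apply, cF_apply]
    apply Complex.ext <;> simp [L.horiz]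
  · rw [cF_apply, cF_apply]
    apply Complex.ext <;> simp [L.vert]

theorem cF_iter (L : DehnLift) (fhat : Cyl → Cyl)
    (hfhat : ∀ z : ℝ × ℝ, projCyl (L.F z) = fhat (projCyl z)) (n : ℕ) (z : ℂ) :
    fhat^[n] (projCyl (z.re, z.im)) = projCyl (((cF L)^[n] z).re, ((cF L)^[n] z).im) := by
  induction n with
  | zero => rfl
  | succ n ih =>
    rw [Function.iterate_succ_apply', ih, ← hfhat, Function.iterate_succ_apply', cF_pair]

theorem rot_eq (L : DehnLift) (fhat : Cyl → Cyl)
    (hfhat : ∀ z : ℝ × ℝ, projCyl (L.F z) = fhat (projCyl z)) : rotSet fhat = rotP (cF L) := by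
  have h : ∀ n : ℕ, {r : ℝ | ∃ z : Cyl, r = ((fhat^[n] z).2 - z.2) / n} = avg (cF L) n := by
    intro n
    ext r
    constructor
    · rintro ⟨⟨x, y⟩, rfl⟩
      obtain ⟨x, rfl⟩ := QuotientAddGroup.mk_surjective x
      refine ⟨⟨x, y⟩, ?_⟩
      have := cF_iter L fhat hfhat n ⟨x, y⟩
      have e : projCyl ((⟨x, y⟩ : ℂ).re, (⟨x, y⟩ : ℂ).im) = (QuotientAddGroup.mk x, y) := rfl
      rw [e] at this
      rw [this]
      rfl
    · rintro ⟨z, rfl⟩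
      refine ⟨projCyl (z.re, z.im), ?_⟩
      rw [cF_iter L fhat hfhat n z]
      rfl
  unfold rotSet rotP
  simp only [h]

theorem cF_min (L : DehnLift) (f : Torus ≃ₜ Torus)
    (hf : ∀ z : ℝ × ℝ, projTorus (L.F z) = f (projTorus z))
    (hmin : ∀ x : Torus, Dense (Set.range fun n : ℤ => (f.toEquiv ^ n) x)) : MinP (cF L) := by
  intro E hE hne hlat hfw
  set P : ℂ → Torus := fun z => projTorus (z.re, z.im) with hP
  have hPopen : IsOpenMap P := by
    have h1 : IsOpenMap (fun x : ℝ => (x : AddCircle (1 : ℝ))) := QuotientAddGroup.isOpenMap_coe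
    have h2 := h1.prodMap h1
    exact h2.comp equivRealProdCLM.toHomeomorph.isOpenMap
  have hPsurj : Function.Surjective P := by
    rintro ⟨x, y⟩
    obtain ⟨x, rfl⟩ := QuotientAddGroup.mk_surjective x
    obtain ⟨y, rfl⟩ := QuotientAddGroup.mk_surjective y
    exact ⟨⟨x, y⟩, rfl⟩
  have hPeq : ∀ z w, P z = P w → ∃ a b : ℤ, w = z + a + b * I := by
    intro z w hzw
    have h1 := congrArg Prod.fst hzw
    have h2 := congrArg Prod.snd hzw
    change (z.re : AddCircle (1 : ℝ)) = (w.re : AddCircle (1 : ℝ)) at h1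
    change (z.im : AddCircle (1 : ℝ)) = (w.im : AddCircle (1 : ℝ)) at h2
    rw [QuotientAddGroup.eq, AddSubgroup.mem_zmultiples_iff] at h1 h2
    obtain ⟨a, ha⟩ := h1
    obtain ⟨b, hb⟩ := h2
    simp at ha hb
    refine ⟨a, b, ?_⟩
    apply Complex.ext
    · simp; linarith
    · simp; linarith
  have hPF : ∀ z, P (cF L z) = f (P z) := by
    intro z
    simp only [hP]
    rw [cF_pair, hf]
  set C : Set Torus := P '' E with hC
  have hsat : ∀ z, P z ∈ C → z ∈ E := by
    rintro z ⟨w, hw, hwz⟩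
    obtain ⟨a, b, rfl⟩ := hPeq w z hwz
    exact hlat w hw a b
  have hCc : IsClosed C := by
    have e : Cᶜ = P '' Eᶜ := by
      ext x
      obtain ⟨z, rfl⟩ := hPsurj x
      constructor
      · intro hx
        exact ⟨z, fun hz => hx ⟨z, hz, rfl⟩, rfl⟩
      · rintro ⟨w, hw, hwz⟩ hz
        exact hw (hsat w (hwz ▸ hz))
    rw [← isOpen_compl_iff, e]
    exact hPopen _ hE.isOpen_compl
  have hfC : ∀ x ∈ C, f x ∈ C := by
    rintro _ ⟨z, hz, rfl⟩
    exact ⟨cF L z, hfw z hz, hPF z⟩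
  have hcl : ∀ n : ℕ, IsClosed {x | f.symm^[n] x ∈ C} := fun n =>
    hCc.preimage (f.symm.continuous.iterate n)
  obtain ⟨x, hx⟩ := IsCompact.nonempty_iInter_of_sequence_nonempty_isCompact_isClosed
    (fun n : ℕ => {x | f.symm^[n] x ∈ C})
    (by
      intro n x hx
      have h1 : f.symm^[n + 1] x ∈ C := hx
      rw [Function.iterate_succ_apply'] at h1
      have h2 := hfC _ h1
      rwa [f.apply_symm_apply] at h2)
    (by
      intro n
      obtain ⟨z, hz⟩ := hne
      refine ⟨f^[n] (P z), ?_⟩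
      change f.symm^[n] (f^[n] (P z)) ∈ C
      rw [Function.LeftInverse.iterate f.symm_apply_apply n]
      exact ⟨z, hz, rfl⟩)
    (hcl 0).isCompact hcl
  rw [Set.mem_iInter] at hx
  have horb : Set.range (fun n : ℤ => (f.toEquiv ^ n) x) ⊆ C := by
    rintro _ ⟨n, rfl⟩
    obtain ⟨m, rfl | rfl⟩ := Int.eq_nat_or_neg n
    · simp only [zpow_natCast]
      induction m with
      | zero => exact hx 0
      | succ m ih =>
        rw [pow_succ', Equiv.Perm.mul_apply]
        exact hfC _ ih
    · simp only [zpow_neg, zpow_natCast, ← inv_pow]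
      have e : ((f.toEquiv)⁻¹ ^ m) x = f.symm^[m] x := by
        clear hx
        induction m with
        | zero => rfl
        | succ m ih =>
          rw [pow_succ', Equiv.Perm.mul_apply, ih, Function.iterate_succ_apply']
          rfl
      rw [e]
      exact hx m
  have hCu : C = Set.univ := by
    rw [← hCc.closure_eq]
    exact (Dense.mono horb (hmin x)).closure_eq
  ext z
  simp only [Set.mem_univ, iff_true]
  exact hsat z (hCu ▸ Set.mem_univ _)

end MinTwist

/-- If a torus homeomorphism `f` homotopic to a Dehn twist is
minimal, then the vertical rotation set of any lift `f̂` to the cylinder is a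
single irrational point. -/
theorem minimal_implies_irrational_rotSet
    (L : DehnLift) (f : Torus ≃ₜ Torus)
    (hf : ∀ z : ℝ × ℝ, projTorus (L.F z) = f (projTorus z))
    (fhat : Cyl → Cyl)
    (hfhat : ∀ z : ℝ × ℝ, projCyl (L.F z) = fhat (projCyl z))
    (hmin : ∀ x : Torus, Dense (Set.range fun n : ℤ => (f.toEquiv ^ n) x)) :
    ∃ α : ℝ, Irrational α ∧ rotSet fhat = {α} := by
  rw [MinTwist.rot_eq L fhat hfhat]
  exact MinTwist.Good.rot (k := L.k) ⟨MinTwist.cF_tw L, MinTwist.cF_min L f hf hmin⟩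
end
end

section
/- Let f be a homeomorphism of the torus T² homotopic to a Dehn twist, with lift f̂ to the vertical cylinder A. Suppose ρ_V(f̂) = [a, p/q], for some integers p, q ≥ 1 and some real a < p/q. Then there exists M > 0 such that for all ẑ ∈ A and all integers n > 0, p₂(f̂ⁿ(ẑ)) − p₂(ẑ) − n·(p/q) < M. -/
noncomputable section

open MeasureTheory

open Set Topology

lemma not_hit_lt {g : ℝ → ℝ} (hg : Continuous g) {v : ℝ} (hv : ∀ t ∈ Icc (0:ℝ) 1, g t ≠ v)
    (h0 : g 0 < v) : g 1 < v := by
  by_contra h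
  push Not at h
  obtain ⟨t, ht, hh⟩ := intermediate_value_Icc (zero_le_one' ℝ) hg.continuousOn ⟨h0.le, h⟩
  exact hv t ht hh

lemma not_hit_gt {g : ℝ → ℝ} (hg : Continuous g) {v : ℝ} (hv : ∀ t ∈ Icc (0:ℝ) 1, g t ≠ v)
    (h0 : v < g 0) : v < g 1 := by
  by_contra h
  push Not at h
  obtain ⟨t, ht, hh⟩ := intermediate_value_Icc' (zero_le_one' ℝ) hg.continuousOn ⟨h, h0.le⟩
  exact hv t ht hh

/-- two planar paths in a half plane which must cross -/
lemma crossing {A B : Set (ℝ × ℝ)} {s a a' b : ℝ} {q : ℝ × ℝ}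
    (hab : a < b) (hba : b < a')
    (hA : JoinedIn A (a, s) (a', s)) (hB : JoinedIn B (b, s) q)
    (hA' : ∀ z ∈ A, s ≤ z.2 ∧ z.2 < q.2) (hB' : ∀ z ∈ B, s ≤ z.2) : (A ∩ B).Nonempty := by
  by_contra hne
  obtain ⟨α, hα⟩ := hA
  obtain ⟨β, hβ⟩ := hB
  have hαm : ∀ t, α.extend t ∈ A := by
    intro t
    have : α.extend t ∈ range α.extend := ⟨t, rfl⟩
    rw [Path.extend_range] at this
    obtain ⟨u, hu⟩ := this
    rw [← hu]; exact hα u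
  have hβm : ∀ t, β.extend t ∈ B := by
    intro t
    have : β.extend t ∈ range β.extend := ⟨t, rfl⟩
    rw [Path.extend_range] at this
    obtain ⟨u, hu⟩ := this
    rw [← hu]; exact hβ u
  set f : ℝ → ℝ × ℝ := ⇑α.extend with hf
  set g : ℝ → ℝ × ℝ := ⇑β.extend with hg
  have fc : Continuous f := α.extend.continuous
  have gc : Continuous g := β.extend.continuous
  have f0 : f 0 = (a, s) := α.extend_zero
  have f1 : f 1 = (a', s) := α.extend_one
  have g0 : g 0 = (b, s) := β.extend_zero
  have g1 : g 1 = q := β.extend_one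
  let Φ : ℝ × ℝ → ℂ := fun p => ⟨(f p.1).1 - (g p.2).1, (f p.1).2 - (g p.2).2⟩
  have Φne : ∀ p, Φ p ≠ 0 := by
    intro p hp
    apply hne
    refine ⟨f p.1, hαm _, ?_⟩
    have h1 : (f p.1).1 - (g p.2).1 = 0 := congrArg Complex.re hp
    have h2 : (f p.1).2 - (g p.2).2 = 0 := congrArg Complex.im hp
    have : f p.1 = g p.2 := Prod.ext (by linarith) (by linarith)
    rw [this]; exact hβm _
  have Φc : Continuous Φ := by
    have : Φ = fun p => (((f p.1).1 - (g p.2).1 : ℝ) : ℂ) + (((f p.1).2 - (g p.2).2 : ℝ) : ℂ) * Complex.I := by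
      funext p
      apply Complex.ext <;> simp [Φ]
    rw [this]; fun_prop
  let Ψ : C(ℝ × ℝ, {z : ℂ // z ≠ 0}) := ⟨fun p => ⟨Φ p, Φne p⟩, Φc.subtype_mk _⟩
  have hΦ00 : Φ (0, 0) = ((a - b : ℝ) : ℂ) := by
    apply Complex.ext <;> simp [Φ, f0, g0]
  have hlog : Complex.exp (⟨Real.log (b - a), Real.pi⟩ : ℂ) = Φ (0,0) := by
    rw [hΦ00]
    have : (⟨Real.log (b - a), Real.pi⟩ : ℂ) = (Real.log (b - a) : ℂ) + Real.pi * Complex.I := by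
      apply Complex.ext <;> simp
    rw [this, Complex.exp_add, Complex.exp_pi_mul_I, ← Complex.ofReal_exp,
      Real.exp_log (by linarith)]
    push_cast; ring
  obtain ⟨L, ⟨hL0, hL⟩, -⟩ := Complex.isCoveringMap_exp.existsUnique_continuousMap_lifts Ψ (0,0)
    (⟨Real.log (b - a), Real.pi⟩ : ℂ) (by apply Subtype.ext; exact hlog)
  have hexp : ∀ p, Complex.exp (L p) = Φ p := fun p => congrArg Subtype.val (congrFun hL p)
  let θ : ℝ × ℝ → ℝ := fun p => (L p).im
  have θc : Continuous θ := by fun_prop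
  have him : ∀ p, Real.exp (L p).re * Real.sin (θ p) = (f p.1).2 - (g p.2).2 := by
    intro p
    rw [← Complex.exp_im, hexp]
  have hre : ∀ p, Real.exp (L p).re * Real.cos (θ p) = (f p.1).1 - (g p.2).1 := by
    intro p
    rw [← Complex.exp_re, hexp]
  have θ0 : θ (0,0) = Real.pi := by simp [θ, hL0]
  have pp := Real.pi_pos
  have hit_pos : ∀ p, (f p.1).2 - (g p.2).2 ≤ 0 → θ p ≠ Real.pi / 2 := by
    intro p hp h
    have := him p
    rw [h, Real.sin_pi_div_two] at this
    have := Real.exp_pos (L p).re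
    linarith
  -- bottom side
  have e1 : θ (1, 0) < Real.pi + Real.pi / 2 := by
    apply not_hit_lt (g := fun t => θ (t, 0)) (by fun_prop)
    · intro t _ h
      have h' := him (t, 0)
      rw [h, Real.sin_add, Real.sin_pi_div_two] at h'
      have := Real.exp_pos (L (t,0)).re
      have := (hA' _ (hαm t)).1
      simp [g0] at h'
      linarith
    · simp only [θ0]; linarith
  have e2 : -(Real.pi / 2) < θ (1, 0) := by
    apply not_hit_gt (g := fun t => θ (t, 0)) (by fun_prop)
    · intro t _ h
      have h' := him (t, 0)
      rw [h, Real.sin_neg, Real.sin_pi_div_two] at h'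
      have := Real.exp_pos (L (t,0)).re
      have := (hA' _ (hαm t)).1
      simp [g0] at h'
      linarith
    · simp only [θ0]; linarith
  have e3 : θ (1, 0) < Real.pi / 2 := by
    by_contra h
    push Not at h
    have h1 := Real.cos_nonpos_of_pi_div_two_le_of_le h (by linarith)
    have h2 := hre (1, 0)
    simp [f1, g0] at h2
    have := Real.exp_pos (L (1,0)).re
    nlinarith
  have e4 : θ (1, 1) < Real.pi / 2 := by
    apply not_hit_lt (g := fun t => θ (1, t)) (by fun_prop) _ e3
    intro t _
    apply hit_pos
    have := hB' _ (hβm t)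
    simp [f1]; linarith
  have e5 : Real.pi / 2 < θ (0, 1) := by
    apply not_hit_gt (g := fun t => θ (0, t)) (by fun_prop) _ (by simp only [θ0]; linarith)
    intro t _
    apply hit_pos
    have := hB' _ (hβm t)
    simp [f0]; linarith
  have e6 : Real.pi / 2 < θ (1, 1) := by
    apply not_hit_gt (g := fun t => θ (t, 1)) (by fun_prop) _ e5
    intro t _
    apply hit_pos
    have := (hA' _ (hαm t)).2
    simp [g1]; linarith
  linarith


/-- a joined pair is joined inside the path component -/
lemma JoinedIn.inComp {P : Set (ℝ × ℝ)} {x y : ℝ × ℝ} (h : JoinedIn P x y) :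
    JoinedIn {w | w ∈ P ∧ JoinedIn P x w} x y := by
  have h1 := (isPathConnected_pathComponentIn (F := P) (x := x) h.source_mem).joinedIn x
    (mem_pathComponentIn_self h.source_mem) y h
  exact h1.mono fun w hw => ⟨JoinedIn.target_mem hw, hw⟩

lemma vseg (x : ℝ) {a b : ℝ} (hab : a ≤ b) :
    JoinedIn {z : ℝ × ℝ | z.1 = x ∧ a ≤ z.2 ∧ z.2 ≤ b} (x, a) (x, b) := by
  have h : IsPathConnected ((fun t : ℝ => ((x, t) : ℝ × ℝ)) '' Icc a b) :=
    ((convex_Icc a b).isPathConnected (nonempty_Icc.2 hab)).image (by fun_prop)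
  refine (h.joinedIn (x, a) ⟨a, ⟨le_rfl, hab⟩, rfl⟩ (x, b) ⟨b, ⟨hab, le_rfl⟩, rfl⟩).mono ?_
  rintro _ ⟨t, ht, rfl⟩
  exact ⟨rfl, ht.1, ht.2⟩

lemma lastExit {Q : Set (ℝ × ℝ)} {p z : ℝ × ℝ} {s : ℝ} (h : JoinedIn Q p z)
    (hp : p.2 ≤ s) (hz : s ≤ z.2) : ∃ u, JoinedIn (Q ∩ {w | s ≤ w.2}) (u, s) z := by
  obtain ⟨γ, hγ⟩ := h
  have hm : ∀ t, γ.extend t ∈ Q := by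
    intro t
    have : γ.extend t ∈ range γ.extend := ⟨t, rfl⟩
    rw [Path.extend_range] at this
    obtain ⟨u, hu⟩ := this
    rw [← hu]; exact hγ u
  obtain ⟨f, hf⟩ : ∃ f : ℝ → ℝ × ℝ, f = ⇑γ.extend := ⟨_, rfl⟩
  have fc : Continuous f := by rw [hf]; exact γ.extend.continuous
  have f0 : f 0 = p := by rw [hf]; exact γ.extend_zero
  have f1 : f 1 = z := by rw [hf]; exact γ.extend_one
  have hm' : ∀ t, f t ∈ Q := by rw [hf]; exact hm
  have hcomp : IsCompact (Icc (0:ℝ) 1 ∩ {t | (f t).2 ≤ s}) :=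
    isCompact_Icc.inter_right (isClosed_le (by fun_prop) continuous_const)
  obtain ⟨t0, ⟨ht0, ht0s⟩, ht0m⟩ := hcomp.exists_isGreatest ⟨0, ⟨le_rfl, zero_le_one⟩, by
    simpa [f0] using hp⟩
  simp only [mem_ofPred_eq] at ht0s
  have key : ∀ t ∈ Icc t0 1, s ≤ (f t).2 := by
    intro t ht
    by_contra hlt
    push Not at hlt
    obtain ⟨t1, ht1, h1⟩ := intermediate_value_Icc ht.2
      (f := fun t => (f t).2) (by fun_prop) (show s ∈ Icc (f t).2 (f 1).2 from
        ⟨hlt.le, by rw [f1]; exact hz⟩)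
    have h2 : t1 ≤ t0 := ht0m ⟨⟨by linarith [ht0.1, ht.1, ht1.1], ht1.2⟩, h1.le⟩
    have h3 : t1 = t := by linarith [ht.1, ht1.1]
    rw [h3] at h1
    simp only at h1
    linarith
  have e0 : f t0 = ((f t0).1, s) := Prod.ext rfl (le_antisymm ht0s (key t0 ⟨le_rfl, ht0.2⟩))
  refine ⟨(f t0).1, ?_⟩
  rw [← e0, ← f1]
  have hpc : IsPathConnected (f '' Icc t0 1) :=
    ((convex_Icc t0 1).isPathConnected (nonempty_Icc.2 ht0.2)).image fc
  refine (hpc.joinedIn (f t0) ⟨t0, ⟨le_rfl, ht0.2⟩, rfl⟩ (f 1) ⟨1, ⟨ht0.2, le_rfl⟩, rfl⟩).mono ?_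
  rintro _ ⟨t, ht, rfl⟩
  exact ⟨hm' t, key t ht⟩

/-- integer iterates of a plane homeomorphism -/
def itz (G : (ℝ × ℝ) ≃ₜ (ℝ × ℝ)) (i : ℤ) (z : ℝ × ℝ) : ℝ × ℝ :=
  (G ^ i : (ℝ × ℝ) ≃ₜ (ℝ × ℝ)) z

lemma itz_zero (G : (ℝ × ℝ) ≃ₜ (ℝ × ℝ)) (z : ℝ × ℝ) : itz G 0 z = z := by
  simp [itz]

lemma itz_one (G : (ℝ × ℝ) ≃ₜ (ℝ × ℝ)) (z : ℝ × ℝ) : itz G 1 z = G z := by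
  simp [itz]

lemma itz_add (G : (ℝ × ℝ) ≃ₜ (ℝ × ℝ)) (i j : ℤ) (z : ℝ × ℝ) :
    itz G (i + j) z = itz G i (itz G j z) := by
  simp only [itz, zpow_add]; rfl

lemma itz_neg (G : (ℝ × ℝ) ≃ₜ (ℝ × ℝ)) (i : ℤ) (z : ℝ × ℝ) :
    itz G (-i) (itz G i z) = z := by
  rw [← itz_add, neg_add_cancel, itz_zero]

lemma itz_neg' (G : (ℝ × ℝ) ≃ₜ (ℝ × ℝ)) (i : ℤ) (z : ℝ × ℝ) :
    itz G i (itz G (-i) z) = z := by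
  rw [← itz_add, add_neg_cancel, itz_zero]

lemma itz_cont (G : (ℝ × ℝ) ≃ₜ (ℝ × ℝ)) (i : ℤ) : Continuous (itz G i) :=
  (G ^ i : (ℝ × ℝ) ≃ₜ (ℝ × ℝ)).continuous

lemma itz_G (G : (ℝ × ℝ) ≃ₜ (ℝ × ℝ)) (i : ℤ) (z : ℝ × ℝ) :
    itz G (i + 1) z = G (itz G i z) := by
  rw [add_comm, itz_add, itz_one]

structure TwistHyp (G : (ℝ × ℝ) ≃ₜ (ℝ × ℝ)) (K C : ℝ) : Prop where
  h1 : ∀ z, G (z + (1, 0)) = G z + (1, 0)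
  v1 : ∀ z, G (z + (0, 1)) = G z + (K, 1)
  hK : 1 ≤ K
  Kint : ∃ k : ℤ, K = k
  hC : 1 ≤ C
  c2 : ∀ z, |(G z).2 - z.2| ≤ C
  c1 : ∀ z, |(G z).1 - z.1 - K * z.2| ≤ C

section
variable {G : (ℝ × ℝ) ≃ₜ (ℝ × ℝ)} {K C : ℝ} (H : TwistHyp G K C)
include H

lemma TwistHyp.inv2 (z : ℝ × ℝ) : |(itz G (-1) z).2 - z.2| ≤ C := by
  have := H.c2 (itz G (-1) z)
  rw [← itz_one G, itz_neg'] at this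
  rwa [abs_sub_comm]

lemma TwistHyp.dispN (n : ℕ) (z : ℝ × ℝ) : |(itz G n z).2 - z.2| ≤ n * C := by
  induction n with
  | zero => simp [itz_zero]
  | succ n ih =>
    push_cast
    rw [itz_G]
    have := H.c2 (itz G n z)
    rw [abs_le] at *
    constructor <;> linarith

lemma TwistHyp.dispNeg (n : ℕ) (z : ℝ × ℝ) : |(itz G (-n) z).2 - z.2| ≤ n * C := by
  have := H.dispN n (itz G (-n) z)
  rw [itz_neg'] at this
  rwa [abs_sub_comm]

lemma TwistHyp.disp (i : ℤ) (z : ℝ × ℝ) : |(itz G i z).2 - z.2| ≤ |(i:ℝ)| * C := by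
  obtain ⟨n, rfl | rfl⟩ := i.eq_nat_or_neg
  · simpa using H.dispN n z
  · simpa using H.dispNeg n z

lemma TwistHyp.shiftx1 (i : ℤ) (z : ℝ × ℝ) : itz G i (z + (1, 0)) = itz G i z + (1, 0) := by
  induction i using Int.induction_on generalizing z with
  | zero => simp [itz_zero]
  | succ n ih => rw [itz_G, ih, H.h1, itz_G]
  | pred n ih =>
    have hg : ∀ w, itz G (-1) (w + (1,0)) = itz G (-1) w + (1,0) := by
      intro w
      have := H.h1 (itz G (-1) w)
      rw [← itz_one, ← itz_one, itz_neg' G 1] at this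
      rw [← this, itz_neg]
    rw [sub_eq_add_neg, itz_add, hg, ih, itz_add]

lemma TwistHyp.shiftx (i j : ℤ) (z : ℝ × ℝ) :
    itz G i (z + ((j : ℝ), 0)) = itz G i z + ((j : ℝ), 0) := by
  induction j using Int.induction_on generalizing z with
  | zero =>
    have e : ((0:ℝ), (0:ℝ)) = 0 := rfl
    simp [e]
  | succ n ih =>
    have e : ∀ w : ℝ × ℝ, w + ((((n : ℤ) + 1 : ℤ) : ℝ), (0:ℝ)) = w + (((n:ℤ) : ℝ), (0:ℝ)) + (1, 0) := by
      intro w; apply Prod.ext <;> simp; ring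
    rw [e, H.shiftx1, ih, e]
  | pred n ih =>
    have e : ∀ w : ℝ × ℝ, w + (((-(n : ℤ) - 1 : ℤ) : ℝ), (0:ℝ)) + (1, 0) = w + (((-(n:ℤ) : ℤ) : ℝ), (0:ℝ)) := by
      intro w; apply Prod.ext <;> simp <;> ring
    have h := H.shiftx1 i (z + (((-(n : ℤ) - 1 : ℤ) : ℝ), (0:ℝ)))
    rw [e, ih] at h
    rw [← add_right_cancel_iff (a := ((1:ℝ), (0:ℝ))), ← h, e]

lemma TwistHyp.shifty1 (n : ℕ) (z : ℝ × ℝ) :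
    ∃ j : ℤ, itz G n (z + (0, 1)) = itz G n z + ((j:ℝ), 1) := by
  obtain ⟨k, hk⟩ := H.Kint
  induction n generalizing z with
  | zero => exact ⟨0, by simp [itz_zero]⟩
  | succ n ih =>
    obtain ⟨j, hj⟩ := ih z
    refine ⟨k + j, ?_⟩
    push_cast
    rw [itz_G, hj, itz_G]
    have e : itz G n z + ((j:ℝ), 1) = itz G n z + ((j:ℝ), 0) + (0, 1) := by
      apply Prod.ext <;> simp
    rw [e, H.v1, ← itz_one G, H.shiftx, hk, itz_one]
    apply Prod.ext <;> simp; ring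

lemma TwistHyp.shifty (n : ℕ) (j : ℤ) (z : ℝ × ℝ) :
    (itz G n (z + (0, (j:ℝ)))).2 = (itz G n z).2 + j := by
  have h1 : ∀ w : ℝ × ℝ, (itz G n (w + (0, 1))).2 = (itz G n w).2 + 1 := by
    intro w
    obtain ⟨j, hj⟩ := H.shifty1 n w
    rw [hj]; simp
  induction j using Int.induction_on generalizing z with
  | zero =>
    have e : ((0:ℝ), (0:ℝ)) = 0 := rfl
    simp [e]
  | succ m ih =>
    have e : z + ((0:ℝ), (((m : ℤ) + 1 : ℤ) : ℝ)) = z + ((0:ℝ), ((m:ℤ) : ℝ)) + (0, 1) := by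
      apply Prod.ext <;> simp; ring
    rw [e, h1, ih]; push_cast; ring
  | pred m ih =>
    have e : z + ((0:ℝ), ((-(m : ℤ) - 1 : ℤ) : ℝ)) + (0, 1) = z + ((0:ℝ), ((-(m:ℤ) : ℤ) : ℝ)) := by
      apply Prod.ext <;> simp <;> ring
    have h := h1 (z + ((0:ℝ), ((-(m : ℤ) - 1 : ℤ) : ℝ)))
    rw [e, ih] at h
    push_cast at h ⊢; linarith

lemma TwistHyp.K0 : 0 < K := by linarith [H.hK]
lemma TwistHyp.C0 : 0 < C := by linarith [H.hC]

lemma TwistHyp.dispx (n : ℕ) (z : ℝ × ℝ) :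
    |(itz G (-n) z).1 - z.1| ≤ n * (C + K * (|z.2| + n * C)) := by
  have hK := H.K0
  have hC := H.C0
  induction n with
  | zero => simp [itz_zero]
  | succ n ih =>
    have e : (-((n + 1 : ℕ) : ℤ)) = -1 + -(n:ℤ) := by push_cast; ring
    have h2 := H.dispNeg (n+1) z
    have h1 := H.c1 (itz G (-((n + 1 : ℕ) : ℤ)) z)
    have e2 : G (itz G (-((n + 1 : ℕ) : ℤ)) z) = itz G (-n) z := by
      rw [e, itz_add, ← itz_one G, itz_neg']
    rw [e2] at h1
    set w := itz G (-((n + 1 : ℕ) : ℤ)) z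
    have h3 : |w.2| ≤ |z.2| + (n+1) * C := by
      have := abs_add_le (w.2 - z.2) z.2
      rw [sub_add_cancel] at this
      push_cast at h2
      linarith
    have h4 : |K * w.2| ≤ K * (|z.2| + (n+1) * C) := by
      rw [abs_mul, abs_of_pos hK]; gcongr
    have h5 : (n:ℝ) * (C + K * (|z.2| + n * C)) ≤ n * (C + K * (|z.2| + (n+1) * C)) := by
      gcongr; linarith
    push_cast
    rw [abs_le] at ih h1 h4 ⊢
    constructor <;> linarith

end


def Aset (G : (ℝ × ℝ) ≃ₜ (ℝ × ℝ)) (l r : ℤ) : Set (ℝ × ℝ) :=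
  {z | ∀ i : ℤ, l ≤ i → i ≤ r → 0 < (itz G i z).2}

/-- the component of `Aset` containing high points -/
def Ucomp (G : (ℝ × ℝ) ≃ₜ (ℝ × ℝ)) (l r : ℤ) : Set (ℝ × ℝ) :=
  {z | ∀ M : ℝ, ∃ w : ℝ × ℝ, M ≤ w.2 ∧ JoinedIn (Aset G l r) z w}

lemma Ucomp_sub {G : (ℝ × ℝ) ≃ₜ (ℝ × ℝ)} {l r : ℤ} {z : ℝ × ℝ} (h : z ∈ Ucomp G l r) :
    z ∈ Aset G l r := by
  obtain ⟨w, -, hw⟩ := h 0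
  exact hw.source_mem

lemma Ucomp_joined {G : (ℝ × ℝ) ≃ₜ (ℝ × ℝ)} {l r : ℤ} {z : ℝ × ℝ} (h : z ∈ Ucomp G l r) (M : ℝ) :
    ∃ w : ℝ × ℝ, M ≤ w.2 ∧ JoinedIn (Ucomp G l r) z w := by
  obtain ⟨w, hM, hw⟩ := h M
  refine ⟨w, hM, hw.inComp.mono ?_⟩
  rintro x ⟨-, hx⟩ M'
  obtain ⟨w', hM', hw'⟩ := h M'
  exact ⟨w', hM', hx.symm.trans hw'⟩

lemma Ucomp_map {G : (ℝ × ℝ) ≃ₜ (ℝ × ℝ)} {l r l' r' : ℤ} {f : ℝ × ℝ → ℝ × ℝ} (hf : Continuous f)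
    {B : ℝ} (hB : ∀ z, |(f z).2 - z.2| ≤ B) (hA : ∀ z ∈ Ucomp G l r, f z ∈ Aset G l' r')
    {z : ℝ × ℝ} (hz : z ∈ Ucomp G l r) : f z ∈ Ucomp G l' r' := by
  intro M
  obtain ⟨w, hM, hw⟩ := Ucomp_joined hz (M + B)
  refine ⟨f w, ?_, (hw.map hf).mono ?_⟩
  · have := (abs_le.1 (hB w)).1
    linarith
  · rintro _ ⟨x, hx, rfl⟩
    exact hA x hx

section
variable {G : (ℝ × ℝ) ≃ₜ (ℝ × ℝ)} {K C : ℝ} (H : TwistHyp G K C)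
include H

/-- iterate inclusion -/
lemma TwistHyp.Ucomp_itz {l r l' r' : ℤ} (i : ℤ) (hl : l ≤ l' + i) (hr : r' + i ≤ r) {z : ℝ × ℝ}
    (hz : z ∈ Ucomp G l r) : itz G i z ∈ Ucomp G l' r' := by
  refine Ucomp_map (itz_cont G i) (H.disp i) ?_ hz
  intro w hw j hj hj'
  rw [← itz_add]
  exact Ucomp_sub hw _ (by omega) (by omega)

lemma TwistHyp.Ucomp_high {l r : ℤ} {z : ℝ × ℝ} (hz : (|(l:ℝ)| + |(r:ℝ)|) * C < z.2) :
    z ∈ Ucomp G l r := by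
  intro M
  refine ⟨(z.1, max M z.2), le_max_left _ _, ?_⟩
  refine (vseg z.1 (le_max_right M z.2)).mono ?_
  rintro w ⟨-, hw, -⟩ i hi hi'
  have h1 := (abs_le.1 (H.disp i w)).1
  have h2 : |(i:ℝ)| ≤ |(l:ℝ)| + |(r:ℝ)| := by
    have a1 : (l:ℝ) ≤ i := by exact_mod_cast hi
    have a2 : (i:ℝ) ≤ r := by exact_mod_cast hi'
    rw [abs_le]
    constructor <;> linarith [neg_abs_le (l:ℝ), le_abs_self (r:ℝ), abs_nonneg (l:ℝ), abs_nonneg (r:ℝ)]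
  have h3 := mul_le_mul_of_nonneg_right h2 H.C0.le
  linarith

lemma TwistHyp.Ucomp_shift {l r : ℤ} (j : ℤ) {z : ℝ × ℝ}
    (hz : z ∈ Ucomp G l r) : z + ((j:ℝ), 0) ∈ Ucomp G l r := by
  refine Ucomp_map (f := fun z => z + ((j:ℝ), 0)) (B := 0) (by fun_prop) (by simp) ?_ hz
  intro w hw i hi hi'
  rw [H.shiftx]
  simpa using Ucomp_sub hw _ hi hi'

lemma TwistHyp.step1 (hU : ∀ M : ℝ, ∃ (n : ℕ) (z : ℝ × ℝ), M ≤ (itz G n z).2 - z.2) (n : ℕ) :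
    ∃ z ∈ Ucomp G 0 n, z.2 ≤ C := by
  by_contra hcon
  push Not at hcon
  have hinv : ∀ z ∈ Ucomp G 0 n, itz G (-1) z ∈ Ucomp G 0 n := by
    intro z hz
    refine Ucomp_map (itz_cont G (-1)) H.inv2 ?_ hz
    intro w hw i hi hi'
    rcases hi.eq_or_lt with rfl | hi0
    · rw [itz_zero]
      have := (abs_le.1 (H.inv2 w)).1
      have := hcon w hw
      linarith
    · rw [← itz_add]
      exact Ucomp_sub hw _ (by omega) (by omega)
  have hinv' : ∀ j : ℕ, ∀ z ∈ Ucomp G 0 n, itz G (-j) z ∈ Ucomp G 0 n := by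
    intro j
    induction j with
    | zero => intro z hz; simpa [itz_zero] using hz
    | succ j ih =>
      intro z hz
      have e : (-((j + 1 : ℕ) : ℤ)) = -1 + -(j:ℤ) := by push_cast; ring
      rw [e, itz_add]
      exact hinv _ (ih z hz)
  obtain ⟨j, z, hz⟩ := hU (n * C + 2)
  have h2 := H.shifty j (-⌈z.2⌉) z
  set w := z + ((0:ℝ), ((-⌈z.2⌉ : ℤ) : ℝ)) with hw
  have hw2 : w.2 = z.2 - ⌈z.2⌉ := by simp [hw]; ring
  have c1 := Int.le_ceil z.2
  have c2 := Int.ceil_lt_add_one z.2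
  push_cast at h2
  have hin : itz G j w ∈ Ucomp G 0 n := by
    apply H.Ucomp_high
    simp
    linarith
  have h3 := Ucomp_sub (hinv' j _ hin) 0 le_rfl (by positivity)
  rw [itz_zero, itz_neg] at h3
  linarith

/-- Step 2 -/
lemma TwistHyp.step2 (hU : ∀ M : ℝ, ∃ (n : ℕ) (z : ℝ × ℝ), M ≤ (itz G n z).2 - z.2)
    (hZ : ∀ ε > (0:ℝ), ∃ N : ℕ, ∀ n ≥ N, ∀ z : ℝ × ℝ, (itz G n z).2 - z.2 ≤ ε * n) (n : ℕ) :
    ∃ z ∈ Ucomp G (-n) n, z.2 ≤ 1 := by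
  suffices h : ∃ z ∈ Ucomp G (-(n+1 : ℕ)) (n+1 : ℕ), z.2 ≤ 1 by
    obtain ⟨z, hz, h1⟩ := h
    refine ⟨z, ?_, h1⟩
    have := H.Ucomp_itz (l' := -n) (r' := n) 0 (by push_cast; omega) (by push_cast; omega) hz
    rwa [itz_zero] at this
  generalize hm : n + 1 = m
  have hmpos : (0:ℝ) < m := by rw [← hm]; positivity
  clear hm
  by_contra hcon
  push Not at hcon
  have hP : ∀ l : ℕ, ∀ z ∈ Ucomp G 0 (2 * m * l : ℕ), (l:ℝ) < (itz G (m * l : ℕ) z).2 := by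
    intro l
    induction l with
    | zero =>
      intro z hz
      simpa using Ucomp_sub hz 0 le_rfl (by positivity)
    | succ l ih =>
      intro z hz
      have hw : itz G m z + ((0:ℝ), ((-1:ℤ):ℝ)) ∈ Ucomp G 0 (2 * m * l : ℕ) := by
        refine Ucomp_map (f := fun z => itz G m z + ((0:ℝ), ((-1:ℤ):ℝ))) (B := m * C + 1)
          ((itz_cont G m).add continuous_const) ?_ ?_ hz
        · intro x
          have := abs_le.1 (H.dispN m x)
          simp only [Prod.snd_add]
          push_cast
          rw [abs_le]; constructor <;> linarith
        · intro x hx i hi hi'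
          obtain ⟨i, rfl⟩ := Int.eq_ofNat_of_zero_le hi
          rw [H.shifty, ← itz_add]
          have hx' : itz G (i + m) x ∈ Ucomp G (-m) m := by
            apply H.Ucomp_itz _ _ _ hx
            · omega
            · push_cast at hi' ⊢
              ring_nf at hi' ⊢
              omega
          have := hcon _ hx'
          push_cast
          linarith
      have := ih _ hw
      rw [H.shifty, ← itz_add] at this
      have e : ((m * (l + 1) : ℕ) : ℤ) = ((m * l : ℕ) : ℤ) + m := by push_cast; ring
      rw [e]
      push_cast at this ⊢
      linarith
  obtain ⟨N, hN⟩ := hZ (1 / (2 * m)) (by positivity)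
  obtain ⟨l, hl⟩ := exists_nat_gt (2 * C + N)
  obtain ⟨z, hz, hzC⟩ := H.step1 hU (2 * m * l)
  have h1 := hP l z hz
  have hlN : N ≤ l := by
    have : (N:ℝ) ≤ l := by linarith [H.C0]
    exact_mod_cast this
  have hm1 : 1 ≤ m := by exact_mod_cast hmpos
  have h2 := hN (m * l) (by nlinarith) z
  have e : 1 / (2 * (m:ℝ)) * ((m * l : ℕ) : ℝ) = l / 2 := by push_cast; field_simp
  rw [e] at h2
  have : (0:ℝ) ≤ N := by positivity
  linarith

/-- Step 3, definition of the critical level -/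
lemma TwistHyp.step3 (hU : ∀ M : ℝ, ∃ (n : ℕ) (z : ℝ × ℝ), M ≤ (itz G n z).2 - z.2)
    (hZ : ∀ ε > (0:ℝ), ∃ N : ℕ, ∀ n ≥ N, ∀ z : ℝ × ℝ, (itz G n z).2 - z.2 ≤ ε * n) :
    ∃ s : ℝ, 0 ≤ s ∧ s ≤ 1 ∧ (∀ ε > 0, ∃ n : ℕ, ∀ z ∈ Ucomp G (-n) n, s - ε < z.2) ∧
      ∀ ε > 0, ∀ n : ℕ, ∃ z ∈ Ucomp G (-n) n, z.2 < s + ε := by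
  set S : Set ℝ := {c | ∃ n : ℕ, ∀ z ∈ Ucomp G (-n) n, c ≤ z.2} with hS
  have h0 : (0:ℝ) ∈ S := ⟨0, fun z hz => by
    have := Ucomp_sub hz 0 (by simp) (by simp)
    rw [itz_zero] at this; exact this.le⟩
  have h1 : ∀ c ∈ S, c ≤ 1 := by
    rintro c ⟨n, hn⟩
    obtain ⟨z, hz, hz1⟩ := H.step2 hU hZ n
    exact (hn z hz).trans hz1
  have hb : BddAbove S := ⟨1, h1⟩
  refine ⟨sSup S, le_csSup hb h0, csSup_le ⟨0, h0⟩ h1, ?_, ?_⟩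
  · intro ε hε
    obtain ⟨c, ⟨n, hn⟩, hc⟩ := exists_lt_of_lt_csSup ⟨0, h0⟩ (show sSup S - ε < sSup S by linarith)
    exact ⟨n, fun z hz => hc.trans_le (hn z hz)⟩
  · intro ε hε n
    by_contra hcon
    push Not at hcon
    have := le_csSup hb (show sSup S + ε ∈ S from ⟨n, hcon⟩)
    linarith

end


/-- invariant set generated by the lower half plane below level `s` -/
def Yset (G : (ℝ × ℝ) ≃ₜ (ℝ × ℝ)) (s : ℝ) : Set (ℝ × ℝ) :=
  {z | ∃ i : ℤ, (itz G i z).2 < s}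

def Pset (G : (ℝ × ℝ) ≃ₜ (ℝ × ℝ)) (s : ℝ) : Set (ℝ × ℝ) := Yset G s ∩ {z | s ≤ z.2}

/-- abstract data carried after Step 3 -/
structure EHyp (G : (ℝ × ℝ) ≃ₜ (ℝ × ℝ)) (s : ℝ) : Prop where
  s0 : 0 ≤ s
  s1 : s ≤ 1
  E : ∀ u u' : ℝ, JoinedIn (Pset G s) (u, s) (u', s) → |u - u'| ≤ 1

lemma EHyp.E2 {G : (ℝ × ℝ) ≃ₜ (ℝ × ℝ)} {s : ℝ} (hE : EHyp G s) {z : ℝ × ℝ} {u u' : ℝ} (h : JoinedIn (Pset G s) (u, s) z)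
    (h' : JoinedIn (Pset G s) (u', s) z) : |u - u'| ≤ 1 := hE.E _ _ (h.trans h'.symm)

lemma Yset_itz {G : (ℝ × ℝ) ≃ₜ (ℝ × ℝ)} {s : ℝ} (j : ℤ) {z : ℝ × ℝ} (h : z ∈ Yset G s) :
    itz G j z ∈ Yset G s := by
  obtain ⟨i, hi⟩ := h
  refine ⟨i - j, ?_⟩
  rw [← itz_add, sub_add_cancel]; exact hi

lemma Yset_low {G : (ℝ × ℝ) ≃ₜ (ℝ × ℝ)} {s : ℝ} {z : ℝ × ℝ} (h : z.2 < s) :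
    z ∈ Yset G s := ⟨0, by rwa [itz_zero]⟩

section
variable {G : (ℝ × ℝ) ≃ₜ (ℝ × ℝ)} {K C : ℝ} (H : TwistHyp G K C)
include H

lemma TwistHyp.Pset_shift {s : ℝ} (j : ℤ) {z : ℝ × ℝ} (h : z ∈ Pset G s) :
    z + ((j:ℝ), 0) ∈ Pset G s := by
  obtain ⟨⟨i, hi⟩, h2⟩ := h
  refine ⟨⟨i, ?_⟩, ?_⟩
  · rw [H.shiftx]; simpa using hi
  · have h2' : s ≤ z.2 := h2
    show s ≤ (z + ((j:ℝ), 0)).2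
    simpa using h2'

lemma TwistHyp.stepE_aux {s : ℝ}
    (hs1 : ∀ ε > 0, ∃ n : ℕ, ∀ z ∈ Ucomp G (-n) n, s - ε < z.2)
    (hs2 : ∀ ε > 0, ∀ n : ℕ, ∃ z ∈ Ucomp G (-n) n, z.2 < s + ε)
    {u u' : ℝ} (hj : JoinedIn (Pset G s) (u, s) (u', s)) (huu : u + 1 < u') : False := by
  obtain ⟨γ, hγ⟩ := hj
  have hcomp : IsCompact (range γ) := isCompact_range γ.continuous
  let O : ℕ → Set (ℝ × ℝ) := fun n => {z | ∃ i : ℤ, |i| ≤ n ∧ (itz G i z).2 < s - 1 / (n + 1)}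
  have hOopen : ∀ n, IsOpen (O n) := by
    intro n
    have : O n = ⋃ i : ℤ, ⋃ _ : |i| ≤ n, {z | (itz G i z).2 < s - 1 / (n + 1)} := by
      ext z; simp [O]
    rw [this]
    refine isOpen_iUnion fun i => isOpen_iUnion fun _ => ?_
    exact isOpen_lt (continuous_snd.comp (itz_cont G i)) continuous_const
  have hOmono : ∀ n m, n ≤ m → O n ⊆ O m := by
    rintro n m hnm z ⟨i, hi, hlt⟩
    refine ⟨i, by omega, hlt.trans_le ?_⟩
    have : (1:ℝ) / (m + 1) ≤ 1 / (n + 1) := by gcongr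
    linarith
  obtain ⟨n, hn⟩ := hcomp.elim_directed_cover O hOopen (by
    rintro _ ⟨t, rfl⟩
    obtain ⟨⟨i, hi⟩, -⟩ := hγ t
    obtain ⟨k, hk⟩ := exists_nat_one_div_lt (sub_pos.2 hi)
    refine mem_iUnion.2 ⟨max k i.natAbs, i, by have := Int.abs_eq_natAbs i; omega, ?_⟩
    have : (1:ℝ) / ((max k i.natAbs : ℕ) + 1) ≤ 1 / (k + 1) := by
      gcongr; exact le_max_left _ _
    linarith) (fun a b => ⟨max a b, hOmono _ _ (le_max_left _ _), hOmono _ _ (le_max_right _ _)⟩)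
  obtain ⟨η, hη, hthick⟩ := hcomp.exists_thickening_subset_open (hOopen n) hn
  obtain ⟨n', hn'⟩ := hs1 (1 / (n + 1)) (by positivity)
  have hdisj : ∀ z ∈ Ucomp G (-(n' + n : ℕ)) (n' + n : ℕ), z ∉ O n := by
    rintro z hz ⟨i, hi, hlt⟩
    have hi' := abs_le.1 hi
    have := hn' _ (H.Ucomp_itz (l' := -n') (r' := n') i (by push_cast; omega) (by push_cast; omega) hz)
    linarith
  obtain ⟨z1, hz1, hz1s⟩ := hs2 η hη (n' + n)
  obtain ⟨M, hM⟩ := (hcomp.image continuous_snd).bddAbove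
  have hM' : ∀ z ∈ range γ, z.2 ≤ M := fun z hz => hM ⟨z, hz, rfl⟩
  set V := Ucomp G (-(n' + n : ℕ)) (n' + n : ℕ) with hV
  obtain ⟨w, hw, hzw⟩ := Ucomp_joined hz1 (max (M + 1) (s + η))
  have hw1 := (le_max_left _ _).trans hw
  have hw2 := (le_max_right _ _).trans hw
  set σ := max z1.2 s with hσ
  have hσs : s ≤ σ := le_max_right _ _
  have hση : σ < s + η := max_lt hz1s (by linarith)
  obtain ⟨x', hx'⟩ := lastExit hzw (le_max_left z1.2 s) (show σ ≤ w.2 by linarith)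
  -- translate
  set j : ℤ := ⌊u - x'⌋ + 1 with hjdef
  have j1 := Int.floor_le (u - x')
  have j2 := Int.lt_floor_add_one (u - x')
  have hjr : (j:ℝ) = ⌊u - x'⌋ + 1 := by rw [hjdef]; push_cast; ring
  have hsh := hx'.map (f := fun z => z + ((j:ℝ), 0)) (by fun_prop)
  have hsh2 : JoinedIn (V ∩ {z | σ ≤ z.2}) (x' + j, σ) (w.1 + j, w.2) := by
    have e1 : ((x', σ) : ℝ × ℝ) + ((j:ℝ), 0) = (x' + j, σ) := by simp
    have e2 : w + ((j:ℝ), 0) = (w.1 + j, w.2) := by apply Prod.ext <;> simp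
    rw [e1, e2] at hsh
    refine hsh.mono ?_
    rintro _ ⟨x, ⟨hx, hx2⟩, rfl⟩
    refine ⟨H.Ucomp_shift j hx, ?_⟩
    have hx2' : σ ≤ x.2 := hx2
    show σ ≤ (x + ((j:ℝ), 0)).2
    simpa using hx2'
  set B : Set (ℝ × ℝ) := {z | z.1 = x' + j ∧ s ≤ z.2 ∧ z.2 ≤ σ} ∪ (V ∩ {z | σ ≤ z.2}) with hB
  have hBj : JoinedIn B (x' + j, s) (w.1 + j, w.2) :=
    ((vseg (x' + j) hσs).mono subset_union_left).trans (hsh2.mono subset_union_right)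
  have hA : JoinedIn (range γ) (u, s) (u', s) := ⟨γ, fun t => mem_range_self t⟩
  obtain ⟨c, hcA, hcB⟩ := crossing (b := x' + j) (by linarith) (by linarith) hA hBj
    (by
      intro z hz
      refine ⟨?_, by have := hM' z hz; simp only; linarith⟩
      obtain ⟨t, rfl⟩ := hz
      exact (hγ t).2)
    (by
      rintro z (⟨-, h, -⟩ | ⟨-, h⟩)
      · exact h
      · exact hσs.trans h)
  rcases hcB with ⟨hc1, hc2, hc3⟩ | ⟨hc, -⟩
  · refine hdisj _ hsh2.source_mem.1 (hthick ?_)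
    rw [Metric.mem_thickening_iff]
    refine ⟨c, hcA, ?_⟩
    rw [Prod.dist_eq, hc1, dist_self, Real.dist_eq]
    refine max_lt hη ?_
    simp only
    rw [abs_lt]; constructor <;> linarith
  · exact hdisj c hc (hn hcA)

lemma TwistHyp.stepE (hU : ∀ M : ℝ, ∃ (n : ℕ) (z : ℝ × ℝ), M ≤ (itz G n z).2 - z.2)
    (hZ : ∀ ε > (0:ℝ), ∃ N : ℕ, ∀ n ≥ N, ∀ z : ℝ × ℝ, (itz G n z).2 - z.2 ≤ ε * n) :
    ∃ s, EHyp G s := by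
  obtain ⟨s, h0, h1, h2, h3⟩ := H.step3 hU hZ
  refine ⟨s, h0, h1, ?_⟩
  intro u u' h
  rw [abs_le]
  constructor
  · by_contra hc
    exact H.stepE_aux h2 h3 h (by linarith)
  · by_contra hc
    exact H.stepE_aux h2 h3 h.symm (by linarith)

/-- Step 4 -/
lemma TwistHyp.step4 {s : ℝ} (hE : EHyp G s) {z : ℝ × ℝ} {u : ℝ}
    (h : JoinedIn (Pset G s) (u, s) z) (hGz : s ≤ (G z).2) :
    ∃ u', JoinedIn (Pset G s) (u', s) (G z) ∧ |u' - u| ≤ C + K * (1 + C) + 1 := by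
  have hK := H.K0
  have hC := H.C0
  have hs0 := hE.s0
  have hs1 := hE.s1
  set Q : Set (ℝ × ℝ) := {w | w.1 = u ∧ s - C ≤ w.2 ∧ w.2 ≤ s} ∪
    {w | w ∈ Pset G s ∧ JoinedIn (Pset G s) (u, s) w} with hQ
  have hQj : JoinedIn Q (u, s - C) z :=
    ((vseg u (by linarith)).mono subset_union_left).trans (h.inComp.mono subset_union_right)
  have hQY : ∀ w ∈ Q, w ∈ Yset G s := by
    rintro w (⟨h1, -, h2⟩ | ⟨h1, -⟩)
    · rcases h2.eq_or_lt with h2 | h2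
      · have : w = (u, s) := Prod.ext h1 h2
        rw [this]; exact h.source_mem.1
      · exact Yset_low h2
    · exact h1.1
  obtain ⟨u', hu'⟩ := lastExit (hQj.map G.continuous) (s := s) (by
    have := (abs_le.1 (H.c2 (u, s - C))).2
    simp only at this
    linarith) hGz
  refine ⟨u', hu'.mono ?_, ?_⟩
  · rintro _ ⟨⟨w, hw, rfl⟩, hw2⟩
    refine ⟨?_, hw2⟩
    have := Yset_itz 1 (hQY w hw)
    rwa [itz_one] at this
  · obtain ⟨⟨w, hw, hGw⟩, -⟩ := hu'.source_mem
    have hc1 := H.c1 w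
    rw [hGw] at hc1
    simp only at hc1
    rcases hw with ⟨h1, h2, h3⟩ | ⟨h1, h2⟩
    · rw [h1] at hc1
      have : |K * w.2| ≤ K * (1 + C) := by
        rw [abs_mul, abs_of_pos hK]
        gcongr
        rw [abs_le]; constructor <;> linarith
      rw [abs_le] at *
      constructor <;> linarith
    · set S : Set (ℝ × ℝ) := {x | (itz G 1 x).1 = u' ∧ s - C ≤ (itz G 1 x).2 ∧ (itz G 1 x).2 ≤ s} with hS
      have hSj : JoinedIn S (itz G (-1) (u', s - C)) (itz G (-1) (u', s)) := by
        refine ((vseg u' (show s - C ≤ s by linarith)).map (itz_cont G (-1))).mono ?_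
        rintro _ ⟨x, hx, rfl⟩
        show _ ∧ _
        rw [itz_neg']
        exact hx
      have ew : itz G (-1) (u', s) = w := by
        rw [← hGw, ← itz_one G, itz_neg]
      rw [ew] at hSj
      have hws : s ≤ w.2 := h1.2
      obtain ⟨u1, hu1⟩ := lastExit hSj (s := s) (by
        have := (abs_le.1 (H.inv2 (u', s - C))).2
        simp only at this
        linarith) hws
      have hYw : w ∈ Yset G s := h1.1
      have hP : JoinedIn (Pset G s) (u1, s) w := by
        refine hu1.mono ?_
        rintro x ⟨⟨a1, a2, a3⟩, a4⟩
        refine ⟨?_, a4⟩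
        rw [← itz_neg G 1 x]
        apply Yset_itz
        rcases a3.eq_or_lt with a3 | a3
        · have : itz G 1 x = itz G 1 w := by
            rw [itz_one G w, hGw]; exact Prod.ext a1 a3
          rw [this]
          exact Yset_itz 1 hYw
        · exact Yset_low a3
      have hd := hE.E2 hP h2
      obtain ⟨⟨b1, b2, b3⟩, -⟩ := hu1.source_mem
      have hc3 := H.c1 (u1, s)
      rw [← itz_one G, b1] at hc3
      simp only at hc3
      have : |K * s| ≤ K * (1 + C) := by
        rw [abs_mul, abs_of_pos hK]
        gcongr
        rw [abs_le]; constructor <;> linarith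
      rw [abs_le] at *
      constructor <;> linarith

/-- pulling a downward vertical segment -/
lemma TwistHyp.exitLemma {s : ℝ} (i : ℤ) {x y : ℝ} (hy : y < s) (hz : s ≤ (itz G i (x, y)).2) :
    ∃ u, JoinedIn (Pset G s ∩ itz G i '' {w | w.1 = x ∧ y - |(i:ℝ)| * C ≤ w.2 ∧ w.2 ≤ y}) (u, s)
      (itz G i (x, y)) := by
  have h0 : 0 ≤ |(i:ℝ)| * C := by have := H.C0; positivity
  obtain ⟨u, hu⟩ := lastExit ((vseg x (show y - |(i:ℝ)| * C ≤ y by linarith)).map (itz_cont G i))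
    (s := s) (by
      have := (abs_le.1 (H.disp i (x, y - |(i:ℝ)| * C))).2
      simp only at this
      linarith) hz
  refine ⟨u, hu.mono ?_⟩
  rintro _ ⟨⟨w, hw, rfl⟩, h2⟩
  exact ⟨⟨Yset_itz i (Yset_low (by linarith [hw.2.2])), h2⟩, ⟨w, hw, rfl⟩⟩

/-- Step 5 -/
lemma TwistHyp.step5 {s δ : ℝ} (hE : EHyp G s) (hδ : 0 < δ)
    (hL : ∀ N : ℕ, ∃ n ≥ N, ∃ z : ℝ × ℝ, (itz G n z).2 - z.2 ≤ -δ * n) (N : ℕ) :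
    ∃ m ≥ N, ∃ (z : ℝ × ℝ) (v : ℝ), s - 1 + δ * m ≤ z.2 ∧
      JoinedIn (Pset G s ∩ {w | |w.1 - v| ≤ 2 * (C + K * (1 + 2 * C)) * m ^ 2}) (v, s) z := by
  have hK := H.K0
  have hC := H.C0
  have hs0 := hE.s0
  have hs1 := hE.s1
  obtain ⟨N1, hN1⟩ := exists_nat_gt (1 / δ)
  obtain ⟨m, hm, z0, hz0⟩ := hL (max N (N1 + 1))
  have hmN : N ≤ m := (le_max_left _ _).trans hm
  have hmN1 : N1 + 1 ≤ m := (le_max_right _ _).trans hm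
  have hm1 : (1:ℝ) ≤ m := by exact_mod_cast (by omega : 1 ≤ m)
  have hδm : 1 < δ * m := by
    have : (N1:ℝ) + 1 ≤ m := by exact_mod_cast hmN1
    rw [div_lt_iff₀ hδ] at hN1
    nlinarith
  set j : ℤ := ⌈s - (itz G m z0).2⌉ - 1 with hj
  have j1 := Int.le_ceil (s - (itz G m z0).2)
  have j2 := Int.ceil_lt_add_one (s - (itz G m z0).2)
  have hjr : (j:ℝ) = ⌈s - (itz G m z0).2⌉ - 1 := by rw [hj]; push_cast; ring
  have hsh := H.shifty m j z0
  set z := z0 + ((0:ℝ), (j:ℝ)) with hz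
  have hz2 : z.2 = z0.2 + j := by simp [hz]
  obtain ⟨x, y, hxy⟩ : ∃ x y, itz G m z = (x, y) := ⟨_, _, rfl⟩
  rw [hxy] at hsh
  simp only at hsh
  have hzz : itz G (-m) (x, y) = z := by rw [← hxy, itz_neg]
  have hys : y < s := by linarith
  have hys1 : s - 1 ≤ y := by linarith
  have hzh : s - 1 + δ * m ≤ z.2 := by linarith
  obtain ⟨v, hv⟩ := H.exitLemma (-m) (x := x) hys (by rw [hzz]; linarith)
  rw [hzz] at hv
  refine ⟨m, hmN, z, v, hzh, hv.mono ?_⟩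
  have key : ∀ w ∈ itz G (-m) '' {w | w.1 = x ∧ y - |((-m : ℤ):ℝ)| * C ≤ w.2 ∧ w.2 ≤ y},
      |w.1 - x| ≤ (C + K * (1 + 2 * C)) * m ^ 2 := by
    rintro _ ⟨w, ⟨h1, h2, h3⟩, rfl⟩
    have h4 := H.dispx m w
    rw [h1] at h4
    simp at h2
    have h5 : |w.2| ≤ 1 + m * C := by
      have : 0 ≤ m * C := by positivity
      rw [abs_le]; constructor <;> linarith
    refine h4.trans ?_
    calc m * (C + K * (|w.2| + m * C)) ≤ m * (m * C + K * ((m + m * C) + m * C)) := by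
          gcongr
          · nlinarith
          · linarith
      _ = (C + K * (1 + 2 * C)) * m ^ 2 := by ring
  rintro w ⟨hw, hw2⟩
  refine ⟨hw, ?_⟩
  have k1 := key _ hw2
  have k2 := key _ hv.source_mem.2
  show |w.1 - v| ≤ _
  rw [abs_le] at *
  simp only at k2
  constructor <;> linarith

end


section
variable {G : (ℝ × ℝ) ≃ₜ (ℝ × ℝ)} {K C : ℝ} (H : TwistHyp G K C)
include H

lemma TwistHyp.trap {s h R v u : ℝ} (hE : EHyp G s) {b z : ℝ × ℝ}
    (hb : JoinedIn (Pset G s ∩ {w | |w.1 - v| ≤ R}) (v, s) b) (hbh : s + h ≤ b.2)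
    (hz : JoinedIn (Pset G s ∩ {w | w.2 < s + h}) (u, s) z) : |z.1 - u| ≤ R + 2 := by
  have hzs : s ≤ z.2 := hz.target_mem.1.2
  have hzh : z.2 < s + h := hz.target_mem.2
  have hR : 0 ≤ R := (abs_nonneg _).trans hb.source_mem.2
  set A : Set (ℝ × ℝ) := {w | w.1 = z.1 ∧ s ≤ w.2 ∧ w.2 ≤ z.2} ∪
    {w | w ∈ Pset G s ∩ {w | w.2 < s + h} ∧
      JoinedIn (Pset G s ∩ {w | w.2 < s + h}) (u, s) w} with hA
  have hAj : JoinedIn A (u, s) (z.1, s) :=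
    (hz.inComp.mono subset_union_right).trans ((vseg z.1 hzs).symm.mono subset_union_left)
  have hAs : ∀ w ∈ A, s ≤ w.2 ∧ w.2 < b.2 := by
    rintro w (⟨-, h1, h2⟩ | ⟨⟨h1, h2⟩, -⟩)
    · exact ⟨h1, by linarith⟩
    · have h2' : w.2 < s + h := h2
      exact ⟨h1.2, by linarith⟩
  have key : ∀ j : ℤ, 1 < |v + j - u| → R < |z.1 - (v + j)| →
      ((u < v + j ∧ v + j < z.1) ∨ (z.1 < v + j ∧ v + j < u)) → False := by
    intro j h1 h2 h3
    have hsh := hb.map (f := fun z => z + ((j:ℝ), 0)) (by fun_prop)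
    have e1 : ((v, s) : ℝ × ℝ) + ((j:ℝ), 0) = (v + j, s) := by simp
    rw [e1] at hsh
    have hsh2 : JoinedIn (Pset G s ∩ {w | |w.1 - (v + j)| ≤ R}) (v + j, s) (b + ((j:ℝ), 0)) := by
      refine hsh.mono ?_
      rintro _ ⟨x, ⟨hx, hx2⟩, rfl⟩
      refine ⟨H.Pset_shift j hx, ?_⟩
      have hx2' : |x.1 - v| ≤ R := hx2
      show |(x + ((j:ℝ), 0)).1 - (v + j)| ≤ R
      simpa using hx2'
    have eb : (b + ((j:ℝ), 0)).2 = b.2 := by simp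
    have hcomp := hsh2.inComp
    have hB : ∀ w ∈ {w | w ∈ Pset G s ∩ {w | |w.1 - (v + j)| ≤ R} ∧
        JoinedIn (Pset G s ∩ {w | |w.1 - (v + j)| ≤ R}) (v + j, s) w}, s ≤ w.2 :=
      fun w hw => hw.1.1.2
    have hne : (A ∩ {w | w ∈ Pset G s ∩ {w | |w.1 - (v + j)| ≤ R} ∧
        JoinedIn (Pset G s ∩ {w | |w.1 - (v + j)| ≤ R}) (v + j, s) w}).Nonempty := by
      rcases h3 with ⟨h3, h4⟩ | ⟨h3, h4⟩
      · exact crossing h3 h4 hAj hcomp (by rw [eb]; exact hAs) hB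
      · exact crossing h3 h4 hAj.symm hcomp (by rw [eb]; exact hAs) hB
    obtain ⟨c, hcA, hcB, hcB2⟩ := hne
    rcases hcA with ⟨hc, -⟩ | ⟨-, hc⟩
    · have : |c.1 - (v + j)| ≤ R := hcB.2
      rw [hc] at this
      linarith
    · have := hE.E2 (hcB2.mono inter_subset_left) (hc.mono inter_subset_left)
      linarith
  by_contra hcon
  push Not at hcon
  rcases lt_abs.1 hcon with hc | hc
  · have j1 := Int.floor_le (u + 1 - v)
    have j2 := Int.lt_floor_add_one (u + 1 - v)
    refine key (⌊u + 1 - v⌋ + 1) (lt_abs.2 (Or.inl ?_)) (lt_abs.2 (Or.inl ?_)) (Or.inl ⟨?_, ?_⟩) <;>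
      push_cast <;> linarith
  · have j1 := Int.le_ceil (u - 1 - v)
    have j2 := Int.ceil_lt_add_one (u - 1 - v)
    refine key (⌈u - 1 - v⌉ - 1) (lt_abs.2 (Or.inr ?_)) (lt_abs.2 (Or.inr ?_)) (Or.inr ⟨?_, ?_⟩) <;>
      push_cast <;> linarith

/-- Step 6: the drift estimate -/
lemma TwistHyp.step6 {s h R v : ℝ} (hE : EHyp G s) (hh : 0 < h) {b : ℝ × ℝ}
    (hb : JoinedIn (Pset G s ∩ {w | |w.1 - v| ≤ R}) (v, s) b) (hbh : s + h ≤ b.2)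
    (hU : ∀ M : ℝ, ∃ (n : ℕ) (z : ℝ × ℝ), M ≤ (itz G n z).2 - z.2) :
    ∃ (l : ℕ) (z : ℝ × ℝ), h / 2 ≤ (itz G (l + 1 : ℕ) z).2 - z.2 ∧
      (1 ≤ l → ((l : ℝ) - 1) * (h / 2 - C - (C + K * (1 + C) + 2)) ≤ 2 * (R + 2)) := by
  have hK := H.K0
  have hC := H.C0
  have hs0 := hE.s0
  have hs1 := hE.s1
  classical
  have hex : ∃ n : ℕ, ∃ z : ℝ × ℝ, z.2 < s ∧ s + h ≤ (itz G n z).2 := by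
    obtain ⟨n, z, hz⟩ := hU (h + 1)
    set j : ℤ := ⌈s - z.2⌉ - 1 with hj
    have j1 := Int.le_ceil (s - z.2)
    have j2 := Int.ceil_lt_add_one (s - z.2)
    have hjr : (j:ℝ) = ⌈s - z.2⌉ - 1 := by rw [hj]; push_cast; ring
    refine ⟨n, z + ((0:ℝ), (j:ℝ)), ?_, ?_⟩
    · simp only [Prod.snd_add]; linarith
    · rw [H.shifty]; linarith
  obtain ⟨z0, hz0, hzn⟩ := Nat.find_spec hex
  have hmin : ∀ i < Nat.find hex, ∀ z : ℝ × ℝ, z.2 < s → (itz G i z).2 < s + h := by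
    intro i hi z hz
    have := Nat.find_min hex hi
    push Not at this
    exact this z hz
  generalize Nat.find hex = n at hzn hmin
  -- last time below the middle level
  set t := Nat.findGreatest (fun i => (itz G i z0).2 < s + h / 2) n with ht
  have ht1 : (itz G t z0).2 < s + h / 2 := by
    refine Nat.findGreatest_spec (P := fun i : ℕ => (itz G i z0).2 < s + h / 2) (Nat.zero_le n) ?_
    simp [itz_zero]; linarith
  have htn : t ≤ n := Nat.findGreatest_le n
  have htlt : t < n := by
    rcases htn.eq_or_lt with e | e
    · rw [e] at ht1; linarith
    · exact e
  have hafter : ∀ i, t < i → i ≤ n → s + h / 2 ≤ (itz G i z0).2 := by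
    intro i h1 h2
    have := Nat.findGreatest_is_greatest (P := fun i : ℕ => (itz G i z0).2 < s + h / 2) h1 h2
    push Not at this
    exact this
  obtain ⟨l, hl⟩ : ∃ l, n = t + 1 + l := ⟨n - t - 1, by omega⟩
  refine ⟨l, itz G t z0, ?_, ?_⟩
  · rw [← itz_add]
    have : (((l + 1 : ℕ) : ℤ) + (t:ℤ)) = (n : ℤ) := by rw [hl]; push_cast; ring
    rw [this]; linarith
  intro hlpos
  have hex2 : ∀ i : ℕ, ∃ u, t < i → i < n →
      JoinedIn (Pset G s ∩ {w | w.2 < s + h}) (u, s) (itz G i z0) := by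
    intro i
    by_cases hi : t < i ∧ i < n
    · obtain ⟨hi1, hi2⟩ := hi
      obtain ⟨u, hu⟩ := H.exitLemma i (x := z0.1) (y := z0.2) hz0 (by
        have := hafter i hi1 hi2.le
        simp only [Prod.mk.eta]; linarith)
      refine ⟨u, fun _ _ => hu.mono ?_⟩
      rintro _ ⟨h1, ⟨w, ⟨-, -, hw⟩, rfl⟩⟩
      exact ⟨h1, hmin i hi2 w (by linarith)⟩
    · exact ⟨0, fun h1 h2 => absurd ⟨h1, h2⟩ hi⟩
  choose u hu using hex2
  have hstep : ∀ i, t < i → i + 1 < n → |u (i+1) - u i| ≤ C + K * (1 + C) + 2 := by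
    intro i h1 h2
    have hGi : G (itz G i z0) = itz G (i + 1 : ℕ) z0 := by push_cast; rw [itz_G]
    have a1 := hu i h1 (by omega)
    have a2 := hu (i+1) (by omega) h2
    obtain ⟨u', hu', hd⟩ := H.step4 hE (a1.mono inter_subset_left) (by
      rw [hGi]; exact a2.target_mem.1.2)
    rw [hGi] at hu'
    have := hE.E2 hu' (a2.mono inter_subset_left)
    rw [abs_le] at *
    constructor <;> linarith
  have hxstep : ∀ i, t < i → i < n → (itz G i z0).1 + h / 2 - C ≤ (itz G (i + 1 : ℕ) z0).1 := by
    intro i h1 h2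
    have hGi : G (itz G i z0) = itz G (i + 1 : ℕ) z0 := by push_cast; rw [itz_G]
    have a1 := (abs_le.1 (H.c1 (itz G i z0))).1
    rw [hGi] at a1
    have a2 := hafter i h1 h2.le
    have : h / 2 ≤ K * (itz G i z0).2 := by nlinarith [H.hK]
    linarith
  have hind : ∀ r : ℕ, r < l → (r:ℝ) * (h / 2 - C - (C + K * (1 + C) + 2)) ≤
      ((itz G (t + 1 + r : ℕ) z0).1 - u (t + 1 + r)) - ((itz G (t + 1 : ℕ) z0).1 - u (t + 1)) := by
    intro r
    induction r with
    | zero => intro _; simp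
    | succ r ih =>
      intro hr
      have a1 := ih (by omega)
      have a2 := hstep (t + 1 + r) (by omega) (by omega)
      have a3 := hxstep (t + 1 + r) (by omega) (by omega)
      have e : t + 1 + (r + 1) = t + 1 + r + 1 := by ring
      rw [e]
      have := (abs_le.1 a2).2
      push_cast at *
      linarith
  have f1 := hind (l - 1) (by omega)
  have f2 := H.trap hE hb hbh (hu (t + 1) (by omega) (by omega))
  have f3 := H.trap hE hb hbh (hu (t + 1 + (l - 1)) (by omega) (by omega))
  rw [Nat.cast_sub (by omega)] at f1
  rw [abs_le] at f2 f3
  push_cast at *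
  linarith

theorem TwistHyp.main {δ : ℝ} (hδ : 0 < δ)
    (hU : ∀ M : ℝ, ∃ (n : ℕ) (z : ℝ × ℝ), M ≤ (itz G n z).2 - z.2)
    (hZ : ∀ ε > (0:ℝ), ∃ N : ℕ, ∀ n ≥ N, ∀ z : ℝ × ℝ, (itz G n z).2 - z.2 ≤ ε * n)
    (hL : ∀ N : ℕ, ∃ n ≥ N, ∃ z : ℝ × ℝ, (itz G n z).2 - z.2 ≤ -δ * n) : False := by
  have hK := H.K0
  have hC := H.C0
  obtain ⟨s, hE⟩ := H.stepE hU hZ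
  set B := 2 * (C + K * (1 + 2 * C)) with hB
  have hB0 : 0 < B := by positivity
  set D := C + K * (1 + C) + 2 with hD
  have hD0 : 0 < D := by positivity
  set ε := δ ^ 2 / (16 * (2 * B + 10)) with hε
  have hε0 : 0 < ε := by positivity
  obtain ⟨N0, hN0⟩ := hZ ε hε0
  have hZ' : ∀ (n : ℕ) (z : ℝ × ℝ), (itz G n z).2 - z.2 ≤ ε * n + N0 * C := by
    intro n z
    rcases le_total N0 n with h | h
    · have := hN0 n h z
      have : 0 ≤ N0 * C := by positivity
      linarith
    · have h1 := (abs_le.1 (H.dispN n z)).2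
      have h2 : (n:ℝ) * C ≤ N0 * C := by gcongr
      have : 0 ≤ ε * n := by positivity
      linarith
  obtain ⟨N, hN⟩ := exists_nat_gt (4 * (C + D + 1 + N0 * C + 1) / δ + δ + 2 + 8 / δ + 8 * ε / δ)
  obtain ⟨m, hm, b, v, hb1, hb2⟩ := H.step5 hE hδ hL N
  have hmr : 4 * (C + D + 1 + N0 * C + 1) / δ + δ + 2 + 8 / δ + 8 * ε / δ < m :=
    hN.trans_le (by exact_mod_cast hm)
  have p1 : 0 < 4 * (C + D + 1 + N0 * C + 1) / δ := by positivity
  have p2 : 0 < 8 / δ := by positivity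
  have p3 : 0 < 8 * ε / δ := by positivity
  have q1 : 4 * (C + D + 1 + N0 * C + 1) < δ * m := by
    have : 4 * (C + D + 1 + N0 * C + 1) / δ < m := by linarith
    rw [div_lt_iff₀ hδ] at this; linarith
  have q2 : 8 * ε < δ * m := by
    have : 8 * ε / δ < m := by linarith
    rw [div_lt_iff₀ hδ] at this; linarith
  have q3 : δ < m := by linarith
  have q4 : (2:ℝ) < m := by linarith
  have hNC : 0 ≤ N0 * C := by positivity
  obtain ⟨l, z, hl1, hl2⟩ := H.step6 (h := δ * m - 2) hE (by linarith) hb2 (by linarith) hU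
  have hl3 := hZ' (l + 1) z
  have r1 : δ * m / 4 ≤ ε * (l + 1) := by push_cast at hl1 hl3; linarith
  have r2 : δ * m / 4 ≤ (δ * m - 2) / 2 - C - D := by linarith
  have r3 : 1 ≤ (l:ℝ) := by
    by_contra hc
    push Not at hc
    nlinarith
  have r4 : ((l:ℝ) - 1) * (δ * m / 4) ≤ 2 * (B * m ^ 2 + 2) :=
    (mul_le_mul_of_nonneg_left r2 (by linarith)).trans (hl2 (by exact_mod_cast r3))
  have r5 : (2 * B + 10) * m ^ 2 ≤ (l + 1) * (δ * m / 4) := by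
    have e : ε * (16 * (2 * B + 10)) = δ ^ 2 := by rw [hε]; field_simp
    have : δ * m / 4 * (δ * m / 4) ≤ ε * (l + 1) * (δ * m / 4) := by gcongr
    have e2 : δ * m / 4 * (δ * m / 4) = ε * ((2 * B + 10) * m ^ 2) := by
      have : δ * m / 4 * (δ * m / 4) = δ ^ 2 * m ^ 2 / 16 := by ring
      rw [this, ← e]; ring
    rw [e2, mul_assoc] at this
    exact le_of_mul_le_mul_left this hε0
  nlinarith

end

lemma bounded_of_periodic {φ : ℝ × ℝ → ℝ} (hc : Continuous φ) (h1 : Function.Periodic φ (1, 0))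
    (h2 : Function.Periodic φ (0, 1)) : ∃ B, ∀ z, |φ z| ≤ B := by
  obtain ⟨B, hB⟩ := ((isCompact_Icc (a := (0:ℝ)) (b := 1)).prod
    (isCompact_Icc (a := (0:ℝ)) (b := 1))).exists_bound_of_continuousOn hc.continuousOn
  refine ⟨B, fun z => ?_⟩
  have e : φ z = φ (Int.fract z.1, Int.fract z.2) := by
    rw [← h1.sub_zsmul_eq (x := z) ⌊z.1⌋, ← h2.sub_zsmul_eq ⌊z.2⌋]
    congr 1
    apply Prod.ext <;> simp
  rw [e]
  exact hB _ ⟨⟨Int.fract_nonneg _, (Int.fract_lt_one _).le⟩, ⟨Int.fract_nonneg _, (Int.fract_lt_one _).le⟩⟩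

lemma exists_twistHyp (G : (ℝ × ℝ) ≃ₜ (ℝ × ℝ)) (k : ℤ) (hk : 0 < k)
    (h1 : ∀ z, G (z + (1, 0)) = G z + (1, 0))
    (v1 : ∀ z, G (z + (0, 1)) = G z + ((k:ℝ), 1)) : ∃ C, TwistHyp G k C := by
  have hG := G.continuous
  obtain ⟨B1, hB1⟩ := bounded_of_periodic (φ := fun z => (G z).2 - z.2) (by fun_prop)
    (by intro z; simp only [h1]; simp) (by intro z; simp only [v1]; simp)
  obtain ⟨B2, hB2⟩ := bounded_of_periodic (φ := fun z => (G z).1 - z.1 - k * z.2) (by fun_prop)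
    (by intro z; simp only [h1]; simp) (by intro z; simp only [v1]; simp; ring)
  refine ⟨max 1 (max B1 B2), h1, v1, by exact_mod_cast hk, ⟨k, rfl⟩, le_max_left _ _, ?_, ?_⟩
  · intro z
    exact (hB1 z).trans ((le_max_left _ _).trans (le_max_right _ _))
  · intro z
    exact (hB2 z).trans ((le_max_right _ _).trans (le_max_right _ _))

lemma TwistHyp.shiftyExact1 {G : (ℝ × ℝ) ≃ₜ (ℝ × ℝ)} {k : ℤ} {C : ℝ} (H : TwistHyp G k C)
    (n : ℕ) (z : ℝ × ℝ) :
    itz G n (z + (0, 1)) = itz G n z + (((n * k : ℤ) : ℝ), 1) := by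
  induction n generalizing z with
  | zero => simp [itz_zero]
  | succ n ih =>
    have e : itz G n z + (((n * k : ℤ) : ℝ), 1) = itz G n z + (((n * k : ℤ) : ℝ), 0) + (0, 1) := by
      apply Prod.ext <;> simp
    have a := ih z
    push_cast at a e ⊢
    rw [itz_G, a, itz_G, e, H.v1]
    have := H.shiftx 1 (n * k) (itz G n z)
    push_cast at this
    rw [← itz_one G, this, itz_one]
    apply Prod.ext <;> simp; ring

lemma TwistHyp.shiftyInt {G : (ℝ × ℝ) ≃ₜ (ℝ × ℝ)} {k : ℤ} {C : ℝ} (H : TwistHyp G k C)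
    (n : ℕ) (l : ℤ) (z : ℝ × ℝ) :
    ∃ j : ℤ, itz G n (z + (0, (l:ℝ))) = itz G n z + ((j:ℝ), (l:ℝ)) := by
  have h1 := H.shiftyExact1 n
  induction l using Int.induction_on generalizing z with
  | zero =>
    have e : ((0:ℝ), (0:ℝ)) = 0 := rfl
    exact ⟨0, by simp [e]⟩
  | succ m ih =>
    obtain ⟨j, hj⟩ := ih z
    refine ⟨j + n * k, ?_⟩
    have e : z + ((0:ℝ), (((m : ℤ) + 1 : ℤ) : ℝ)) = z + ((0:ℝ), ((m:ℤ) : ℝ)) + (0, 1) := by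
      apply Prod.ext <;> simp; ring
    rw [e, h1, hj]; push_cast; apply Prod.ext <;> simp <;> ring
  | pred m ih =>
    obtain ⟨j, hj⟩ := ih z
    refine ⟨j - n * k, ?_⟩
    have e : z + ((0:ℝ), ((-(m : ℤ) - 1 : ℤ) : ℝ)) + (0, 1) = z + ((0:ℝ), ((-(m:ℤ) : ℤ) : ℝ)) := by
      apply Prod.ext <;> simp <;> ring
    have h := h1 (z + ((0:ℝ), ((-(m : ℤ) - 1 : ℤ) : ℝ)))
    rw [e, hj] at h
    have ha := congrArg Prod.fst h
    have hb := congrArg Prod.snd h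
    push_cast at ha hb ⊢
    simp only [Prod.fst_add, Prod.snd_add] at ha hb
    apply Prod.ext
    · simp only [Prod.fst_add]; linarith
    · simp only [Prod.snd_add]; linarith

lemma powHyp (F : (ℝ × ℝ) ≃ₜ (ℝ × ℝ)) (k : ℤ) (hk : 0 < k) {C : ℝ} (H : TwistHyp F k C)
    (Q : ℕ) (hQ : 0 < Q) (p : ℤ) :
    ∃ (G : (ℝ × ℝ) ≃ₜ (ℝ × ℝ)) (C' : ℝ), TwistHyp G ((Q * k : ℤ) : ℝ) C' ∧
      ∀ (n : ℕ) (z : ℝ × ℝ), (itz G n z).2 = (itz F (Q * n : ℕ) z).2 - n * p := by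
  set G : (ℝ × ℝ) ≃ₜ (ℝ × ℝ) := (F ^ (Q:ℤ)).trans (Homeomorph.addRight ((0:ℝ), -(p:ℝ))) with hG
  have hGz : ∀ z, G z = itz F Q z + ((0:ℝ), -(p:ℝ)) := fun z => rfl
  obtain ⟨C', hC'⟩ := exists_twistHyp G (Q * k) (by positivity)
    (by intro z; rw [hGz, hGz, H.shiftx1]; abel)
    (by intro z; rw [hGz, hGz, H.shiftyExact1]; abel)
  refine ⟨G, C', hC', ?_⟩
  have key : ∀ (n : ℕ) (z : ℝ × ℝ), ∃ j : ℤ,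
      itz G n z = itz F (Q * n : ℕ) z + ((j:ℝ), -(n * p : ℝ)) := by
    intro n z
    induction n with
    | zero => exact ⟨0, by simp [itz_zero]⟩
    | succ n ih =>
      obtain ⟨j, hj⟩ := ih
      obtain ⟨j', hj'⟩ := H.shiftyInt Q (-(n * p)) (itz F (Q * n : ℕ) z + ((j:ℝ), 0))
      refine ⟨j + j', ?_⟩
      have e1 : itz F (Q * n : ℕ) z + ((j:ℝ), -(n * p : ℝ)) =
          itz F (Q * n : ℕ) z + ((j:ℝ), 0) + ((0:ℝ), ((-(n * p) : ℤ) : ℝ)) := by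
        apply Prod.ext <;> simp
      have e2 : ((Q * (n + 1) : ℕ) : ℤ) = (Q : ℤ) + ((Q * n : ℕ) : ℤ) := by push_cast; ring
      have e3 : ((n + 1 : ℕ) : ℤ) = (n : ℤ) + 1 := by push_cast; ring
      rw [e2, itz_add, e3, itz_G, hj, hGz, e1, hj', H.shiftx]
      apply Prod.ext <;> simp <;> ring
  intro n z
  obtain ⟨j, hj⟩ := key n z
  rw [hj]; simp; ring

theorem rotSet_rational_endpoint_bounded_deviation
    (L : DehnLift) (fhat : Cyl → Cyl)
    (hfhat : ∀ z : ℝ × ℝ, projCyl (L.F z) = fhat (projCyl z))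
    (p q : ℤ) (hq : 1 ≤ q) (a : ℝ) (ha : a < (p : ℝ) / (q : ℝ))
    (hrot : rotSet fhat = Set.Icc a ((p : ℝ) / (q : ℝ))) :
    ∃ M > (0:ℝ), ∀ z : Cyl, ∀ n : ℕ, 0 < n →
      (fhat^[n] z).2 - z.2 - (n : ℝ) * ((p : ℝ) / (q : ℝ)) < M := by
  obtain ⟨C, H⟩ := exists_twistHyp L.F L.k L.k_pos (fun z => by
      have := L.horiz z.1 z.2
      have e : z + ((1:ℝ), (0:ℝ)) = (z.1 + 1, z.2) := by apply Prod.ext <;> simp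
      rw [e, this]) (fun z => by
      have := L.vert z.1 z.2
      have e : z + ((0:ℝ), (1:ℝ)) = (z.1, z.2 + 1) := by apply Prod.ext <;> simp
      rw [e, this])
  have hproj : ∀ (n : ℕ) (z : ℝ × ℝ), fhat^[n] (projCyl z) = projCyl (itz L.F n z) := by
    intro n z
    induction n with
    | zero => simp [itz_zero]
    | succ n ih =>
      push_cast
      rw [Function.iterate_succ_apply', ih, ← hfhat, itz_G]
  have hsurj : ∀ z : Cyl, ∃ w, projCyl w = z := by
    rintro ⟨x, y⟩
    obtain ⟨x, rfl⟩ := QuotientAddGroup.mk_surjective x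
    exact ⟨(x, y), rfl⟩
  have hdiff : ∀ (n : ℕ) (w : ℝ × ℝ), (fhat^[n] (projCyl w)).2 - (projCyl w).2 =
      (itz L.F n w).2 - w.2 := by
    intro n w; rw [hproj]; rfl
  obtain ⟨Q, rfl⟩ : ∃ Q : ℕ, q = Q := ⟨q.toNat, by omega⟩
  have hQ : 0 < Q := by omega
  have hQr : (1:ℝ) ≤ Q := by exact_mod_cast hQ
  have hQr0 : (0:ℝ) < Q := by linarith
  have hC := H.C0
  simp only [Int.cast_natCast] at *
  set ρ : ℝ := (p:ℝ) / Q with hρ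
  have hρQ : ρ * Q = p := by rw [hρ]; field_simp
  obtain ⟨G, C', HG, hGF⟩ := powHyp L.F L.k L.k_pos H Q hQ p
  by_contra hcon
  push Not at hcon
  -- decomposition of an F-iterate
  have hdec : ∀ (n : ℕ) (w : ℝ × ℝ), |((itz L.F n w).2 - w.2 - n * ρ) -
      ((itz G (n / Q : ℕ) w).2 - w.2)| ≤ Q * C + Q * |ρ| := by
    intro n w
    have hn := Nat.div_add_mod n Q
    set m := n / Q
    have hr : n % Q < Q := Nat.mod_lt _ hQ
    set r := n % Q
    have hrr : (r:ℝ) ≤ Q := by exact_mod_cast hr.le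
    have e : (n:ℤ) = (r:ℤ) + ((Q * m : ℕ) : ℤ) := by rw [← hn]; push_cast; ring
    have e' : (n:ℝ) = Q * m + r := by rw [← hn]; push_cast; ring
    have h1 := H.dispN r (itz L.F (Q * m : ℕ) w)
    rw [← itz_add, ← e] at h1
    have h2 : (r:ℝ) * C ≤ Q * C := by gcongr
    have h3 : |(r:ℝ) * ρ| ≤ Q * |ρ| := by
      rw [abs_mul, abs_of_nonneg (by positivity)]; gcongr
    have h4 : (n:ℝ) * ρ = m * p + r * ρ := by rw [e', ← hρQ]; ring
    rw [hGF, h4]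
    rw [abs_le] at *
    constructor <;> linarith
  -- average bounds for F
  have havg : ∀ (n : ℕ) (w : ℝ × ℝ), 1 ≤ n → ((itz L.F n w).2 - w.2) / n ≤ C := by
    intro n w hn
    have : (0:ℝ) < n := by exact_mod_cast hn
    rw [div_le_iff₀ this]
    have := (abs_le.1 (H.dispN n w)).2
    linarith
  have hZF : ∀ ε > (0:ℝ), ∃ N : ℕ, ∀ n ≥ N, ∀ w : ℝ × ℝ, (itz L.F n w).2 - w.2 ≤ (ρ + ε) * n := by
    intro ε hε
    by_contra hc
    push Not at hc
    set S : ℕ → Set ℝ := fun i => closure (⋃ n : ℕ, ⋃ _ : i + 1 ≤ n,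
      {r : ℝ | ∃ z : Cyl, r = ((fhat^[n] z).2 - z.2) / n}) with hS
    have hne := IsCompact.nonempty_iInter_of_sequence_nonempty_isCompact_isClosed
      (fun i => S i ∩ Icc (ρ + ε) C)
      (by
        intro i
        refine inter_subset_inter_left _ (closure_mono ?_)
        refine iUnion_subset fun n => iUnion_subset fun hn => ?_
        exact subset_iUnion₂_of_subset n (by omega) subset_rfl)
      (by
        intro i
        obtain ⟨n, hn, w, hw⟩ := hc (i + 1)
        have hn0 : (0:ℝ) < n := by exact_mod_cast (by omega : 0 < n)
        refine ⟨((itz L.F n w).2 - w.2) / n, subset_closure ?_, ?_, havg n w (by omega)⟩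
        · exact mem_iUnion₂.2 ⟨n, hn, projCyl w, by rw [hdiff]⟩
        · rw [le_div_iff₀ hn0]; exact hw.le)
      (isCompact_Icc.inter_left isClosed_closure)
      (fun i => isClosed_closure.inter isClosed_Icc)
    obtain ⟨x, hx⟩ := hne
    rw [mem_iInter] at hx
    have hxr : x ∈ rotSet fhat := mem_iInter.2 fun i => (hx i).1
    rw [hrot] at hxr
    have := (hx 0).2.1
    linarith [hxr.2]
  set η : ℝ := (ρ - a) / 2 with hη
  have hη0 : 0 < η := by rw [hη]; linarith
  have hLF : ∀ N : ℕ, ∃ n ≥ N, ∃ w : ℝ × ℝ, (itz L.F n w).2 - w.2 ≤ (ρ - η) * n := by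
    intro N
    have har : a ∈ rotSet fhat := by rw [hrot]; exact ⟨le_rfl, ha.le⟩
    have := mem_iInter.1 har N
    rw [Metric.mem_closure_iff] at this
    obtain ⟨r, hr, hd⟩ := this η hη0
    obtain ⟨n, hn, z, hz⟩ := mem_iUnion₂.1 hr
    obtain ⟨w, rfl⟩ := hsurj z
    have hn0 : (0:ℝ) < n := by exact_mod_cast (by omega : 0 < n)
    refine ⟨n, by omega, w, ?_⟩
    rw [hdiff] at hz
    rw [← div_le_iff₀ hn0, ← hz]
    rw [Real.dist_eq, abs_lt] at hd
    linarith [hd.1]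
  refine HG.main (δ := η / 2) (by positivity) ?_ ?_ ?_
  · intro M
    obtain ⟨z, n, hn, hz⟩ := hcon (max 1 (M + (Q * C + Q * |ρ|))) (by positivity)
    obtain ⟨w, rfl⟩ := hsurj z
    rw [hdiff] at hz
    have h1 := (abs_le.1 (hdec n w)).2
    have h2 := (le_max_right _ _).trans hz
    exact ⟨n / Q, w, by linarith⟩
  · intro ε hε
    obtain ⟨N, hN⟩ := hZF (ε / Q) (by positivity)
    refine ⟨N, fun n hn w => ?_⟩
    have := hN (Q * n) (by nlinarith) w
    rw [hGF]
    have e : (ρ + ε / Q) * ((Q * n : ℕ) : ℝ) = n * p + ε * n := by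
      rw [← hρQ]; push_cast; field_simp
    linarith
  · intro N
    obtain ⟨N1, hN1⟩ := exists_nat_gt (2 * (Q * C + Q * |ρ|) / η)
    obtain ⟨n, hn, w, hw⟩ := hLF (Q * (N + N1))
    have hm : N + N1 ≤ n / Q := by
      rw [Nat.le_div_iff_mul_le hQ]; linarith
    refine ⟨n / Q, by omega, w, ?_⟩
    have h1 := (abs_le.1 (hdec n w)).1
    have h2 : ((n / Q : ℕ) : ℝ) ≤ n := by exact_mod_cast Nat.div_le_self n Q
    have h3 : (N1:ℝ) ≤ ((n / Q : ℕ) : ℝ) := by exact_mod_cast (by omega : N1 ≤ n / Q)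
    rw [div_lt_iff₀ hη0] at hN1
    have h4 := mul_le_mul_of_nonneg_right h3 hη0.le
    have h5 := mul_le_mul_of_nonneg_right h2 hη0.le
    linarith
end
end
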